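/- arXiv:1903.07574 — 3 statements merged into one kernel-verified Lean document; each statement's English description precedes it below -/
import Mathlib

section
/- For every s ≥ 0, φ_1(s) = e^{−s} + (1/π) ∫_0^1 (x/(1−x))^{x} sin(πx) e^{−sx} dx. Consequently, for every z ∈ ℂ with z ∉ [−1,0], f_1(z) = (z+1)^{−1} + (1/π) ∫_0^1 [(x/(1−x))^{x} sin(πx)]/(x+z) dx. -/
open MeasureTheory Filter Set Asymptotics

/-- The sequence of polynomials `p_n(α)` defined by `p_0(α) = 1` and
`p_{n+1}(α) = (α/(n+1)) · Σ_{k=0}^{n} ((k+1)/(k+2)) p_{n−k}(α)`. -/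
noncomputable def bmpP {K : Type*} [Field K] (α : K) : ℕ → K
  | 0 => 1
  | n + 1 => (α / (n + 1)) * ∑ k ∈ Finset.range (n + 1), ((k + 1 : K) / (k + 2)) * bmpP α (n - k)
  decreasing_by exact Nat.lt_succ_of_le (Nat.sub_le n k)

/-- The real function `φ_α(s) = e^α Σ_{n≥0} (−1)^n p_{n+1}(α) s^n/n!` for real `α`. -/
noncomputable def bmpPhiR (α s : ℝ) : ℝ :=
  Real.exp α * ∑' n : ℕ, (-1) ^ n * bmpP α (n + 1) * s ^ n / n.factorial

/-- `f_α(z) = e^α − exp(α z Log(1+1/z))`. -/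
noncomputable def bmpF (α z : ℂ) : ℂ :=
  Complex.exp α - Complex.exp (α * z * Complex.log (1 + 1 / z))

namespace BinomialMean

open Complex Topology Bornology

/-- The boundary-continuous form on the closed upper half-plane of `(z + 1) (1 + 1/z)^z`. -/
noncomputable def upperBranch (z : ℂ) : ℂ := exp ((z + 1) * log (z + 1) - z * log z)

/-- The density `(x / (1 - x))^x sin (π x)`. -/
noncomputable def density (x : ℝ) : ℝ := (x / (1 - x)) ^ x * Real.sin (Real.pi * x)

lemma continuousOn_mul_log : ContinuousOn (fun z : ℂ => z * log z) {z | 0 ≤ z.im} := by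
  intro z hz
  rcases eq_or_ne z 0 with rfl | h0
  · refine ContinuousAt.continuousWithinAt ?_
    have hlim : Tendsto (fun z : ℂ => |‖z‖ * Real.log ‖z‖| + ‖z‖ * Real.pi) (𝓝 0) (𝓝 0) := by
      have h : Continuous (fun z : ℂ => |‖z‖ * Real.log ‖z‖| + ‖z‖ * Real.pi) :=
        (Real.continuous_mul_log.comp continuous_norm).abs.add (by fun_prop)
      simpa using h.tendsto 0
    rw [ContinuousAt]
    simp only [zero_mul]
    refine squeeze_zero_norm (fun z => ?_) hlim
    rw [norm_mul, abs_mul, abs_of_nonneg (norm_nonneg z), ← mul_add]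
    gcongr
    calc ‖log z‖ ≤ |(log z).re| + |(log z).im| := norm_le_abs_re_add_abs_im _
      _ ≤ _ := by
        rw [log_re, log_im]
        gcongr
        exact abs_arg_le_pi z
  · refine continuousWithinAt_id.mul ?_
    by_cases hs : z ∈ slitPlane
    · exact (continuousAt_clog hs).continuousWithinAt
    · rw [mem_slitPlane_iff, not_or, not_lt, not_not] at hs
      refine continuousWithinAt_log_of_re_neg_of_im_zero (lt_of_le_of_ne hs.1 fun h => ?_) hs.2
      exact h0 (Complex.ext h hs.2)

lemma continuousOn_upperBranch : ContinuousOn upperBranch {z | 0 ≤ z.im} := by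
  refine (ContinuousOn.sub ?_ continuousOn_mul_log).cexp
  exact continuousOn_mul_log.comp (f := fun z : ℂ => z + 1) (by fun_prop)
    (fun z hz => by simpa using hz)

lemma differentiableAt_upperBranch {z : ℂ} (hz : z ∈ slitPlane) :
    DifferentiableAt ℂ upperBranch z := by
  have h1 : z + 1 ∈ slitPlane := by
    rw [mem_slitPlane_iff] at *
    rcases hz with h | h
    · left; simp; linarith
    · right; simpa using h
  unfold upperBranch
  exact (((differentiableAt_id.add_const 1).mul ((differentiableAt_id.add_const 1).clog h1)).sub
    (differentiableAt_id.mul (differentiableAt_id.clog hz))).cexp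

lemma upperBranch_eq {z : ℂ} (hz : 0 ≤ z.im) (hz' : z.im = 0 → z.re < -1 ∨ 0 < z.re) :
    upperBranch z = (z + 1) * exp (z * log (1 + 1 / z)) := by
  have h0 : z ≠ 0 := by rintro rfl; simp at hz'; linarith
  have h1 : z + 1 ≠ 0 := by
    intro h
    have : z = -1 := by linear_combination h
    subst this; simp at hz'; linarith
  have h2 : 1 + 1 / z ≠ 0 := by
    have : 1 + 1 / z = (z + 1) / z := by field_simp
    rw [this]; exact div_ne_zero h1 h0
  have him : (1 + 1 / z).im = -z.im / normSq z := by simp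
  have hpos : 0 < normSq z := normSq_pos.2 h0
  have harg : arg z + arg (1 + 1 / z) ∈ Ioc (-Real.pi) Real.pi := by
    have ha := arg_nonneg_iff.2 hz
    have hb : arg (1 + 1 / z) ≤ 0 := by
      rcases hz.lt_or_eq with h | h
      · refine (arg_neg_iff.2 ?_).le
        rw [him]
        exact div_neg_of_neg_of_pos (by linarith) hpos
      · have hr : z = (z.re : ℂ) := Complex.ext rfl (by simpa using h.symm)
        have : (1 + 1 / z) = ((1 + 1 / z.re : ℝ) : ℂ) := by
          conv_lhs => rw [hr]
          push_cast; rfl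
        rw [this, arg_ofReal_of_nonneg]
        rcases hz' h.symm with h' | h'
        · have : z.re ≠ 0 := by linarith
          have : 1 + 1 / z.re = (-z.re - 1) / (-z.re) := by field_simp; ring
          rw [this]
          exact div_nonneg (by linarith) (by linarith)
        · positivity
    exact ⟨by linarith [neg_pi_lt_arg (1 + 1 / z)], by linarith [arg_le_pi z]⟩
  have hlog : log (z + 1) = log z + log (1 + 1 / z) := by
    rw [← (log_mul_eq_add_log_iff h0 h2).2 harg]
    congr 1
    field_simp
  have : (z + 1) * log (z + 1) - z * log z = log (z + 1) + z * log (1 + 1 / z) := by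
    rw [hlog]; ring
  rw [upperBranch, this, exp_add, exp_log h1]

lemma upperBranch_ofReal_im_of_nonneg {x : ℝ} (hx : 0 ≤ x) : (upperBranch x).im = 0 := by
  have : upperBranch x = (Real.exp ((x + 1) * Real.log (x + 1) - x * Real.log x) : ℝ) := by
    rw [upperBranch]
    push_cast
    rw [ofReal_log hx, ofReal_log (by linarith)]
    push_cast
    rfl
  rw [this, ofReal_im]

lemma neg_mul_log_neg {y : ℝ} (hy : 0 ≤ y) :
    (-y : ℂ) * log (-y) = -(y * Real.log y : ℝ) - (y * Real.pi : ℝ) * I := by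
  rcases hy.eq_or_lt with rfl | hy
  · simp
  · have h := log_ofReal_mul hy (x := -1) (by simp)
    rw [mul_neg_one, log_neg_one] at h
    rw [h]
    push_cast
    ring

lemma upperBranch_ofReal_im_of_le {x : ℝ} (hx : x ≤ -1) : (upperBranch x).im = 0 := by
  have h1 := neg_mul_log_neg (y := -x) (by linarith)
  have h2 := neg_mul_log_neg (y := -x - 1) (by linarith)
  have : (x + 1 : ℂ) * log (x + 1) - x * log x =
      (-((-x - 1) * Real.log (-x - 1)) + (-x) * Real.log (-x) : ℝ) + (Real.pi : ℝ) * I := by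
    push_cast at h1 h2 ⊢
    rw [neg_neg] at h1
    rw [neg_sub, sub_neg_eq_add, add_comm (1 : ℂ)] at h2
    rw [h1, h2]
    ring
  rw [upperBranch, this, exp_im, add_re, add_im, ofReal_re, ofReal_im, re_ofReal_mul,
    im_ofReal_mul, I_re, I_im]
  simp

lemma upperBranch_neg_one : upperBranch (-1) = -1 := by
  simp [upperBranch, log_neg_one, exp_pi_mul_I]

lemma one_sub_mul_density {y : ℝ} (h0 : 0 < y) (h1 : y < 1) :
    (1 - y) * density y =
      Real.exp ((1 - y) * Real.log (1 - y) + y * Real.log y) * Real.sin (Real.pi * y) := by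
  have h2 : 0 < 1 - y := by linarith
  have : (1 - y) * Real.log (1 - y) + y * Real.log y =
      Real.log (1 - y) + Real.log (y / (1 - y)) * y := by
    rw [Real.log_div h0.ne' h2.ne']; ring
  rw [density, this, Real.exp_add, Real.exp_log h2, Real.rpow_def_of_pos (by positivity)]
  ring

lemma upperBranch_neg_im {y : ℝ} (h0 : 0 < y) (h1 : y < 1) :
    (upperBranch (-y : ℝ)).im = (1 - y) * density y := by
  have h2 := neg_mul_log_neg h0.le
  have : ((-y : ℝ) + 1 : ℂ) * log ((-y : ℝ) + 1) - (-y : ℝ) * log (-y : ℝ) =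
      ((1 - y) * Real.log (1 - y) + y * Real.log y : ℝ) + (Real.pi * y : ℝ) * I := by
    have h3 := ofReal_log (x := 1 - y) (by linarith)
    push_cast at h2 h3 ⊢
    rw [h2, neg_add_eq_sub, h3]
    ring
  rw [upperBranch, this, one_sub_mul_density h0 h1, exp_im, add_re, add_im, ofReal_re, ofReal_im,
    re_ofReal_mul, im_ofReal_mul, I_re, I_im]
  simp

lemma density_nonneg {y : ℝ} (h0 : 0 < y) (h1 : y < 1) : 0 ≤ density y := by
  have h2 : 0 < 1 - y := by linarith
  refine mul_nonneg (by positivity) (Real.sin_nonneg_of_nonneg_of_le_pi (by positivity) ?_)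
  nlinarith [Real.pi_pos]

lemma density_le_pi {y : ℝ} (h0 : 0 < y) (h1 : y < 1) : density y ≤ Real.pi := by
  have h2 : 0 < 1 - y := by linarith
  refine le_of_mul_le_mul_left ?_ h2
  rw [one_sub_mul_density h0 h1]
  have h3 : Real.sin (Real.pi * y) ≤ Real.pi * (1 - y) := by
    rw [← Real.sin_pi_sub, show Real.pi - Real.pi * y = Real.pi * (1 - y) by ring]
    exact Real.sin_le (by positivity)
  have h4 : Real.exp ((1 - y) * Real.log (1 - y) + y * Real.log y) ≤ 1 := by
    rw [Real.exp_le_one_iff]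
    have := Real.log_nonpos h2.le (by linarith)
    have := Real.log_nonpos h0.le h1.le
    nlinarith
  have h5 : 0 ≤ Real.pi * (1 - y) := by positivity
  calc _ ≤ Real.exp ((1 - y) * Real.log (1 - y) + y * Real.log y) * (Real.pi * (1 - y)) := by gcongr
    _ ≤ 1 * (Real.pi * (1 - y)) := by gcongr
    _ = _ := by ring

lemma measurable_density : Measurable density := by
  unfold density
  fun_prop

lemma norm_density_le {y : ℝ} (hy : y ∈ Ioo (0 : ℝ) 1) : ‖density y‖ ≤ Real.pi := by
  rw [Real.norm_of_nonneg (density_nonneg hy.1 hy.2)]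
  exact density_le_pi hy.1 hy.2

lemma integrableOn_density : IntegrableOn density (Ioo 0 1) :=
  Measure.integrableOn_of_bounded (M := Real.pi) (by simp)
    measurable_density.aestronglyMeasurable
    ((ae_restrict_iff' measurableSet_Ioo).2 (.of_forall fun _ => norm_density_le))

lemma tendsto_intervalIntegral_of_isLittleO {G : ℂ → ℂ} (hc : ContinuousOn G {z | 0 ≤ z.im})
    (hd : DifferentiableOn ℂ G {z | 0 < z.im})
    (hlim : Tendsto (fun z => z * G z) (cobounded ℂ ⊓ 𝓟 {z | 0 ≤ z.im}) (𝓝 0)) :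
    Tendsto (fun R : ℝ => ∫ x in (-R)..R, G x) atTop (𝓝 0) := by
  rw [Metric.tendsto_nhds]
  intro ε hε
  have hev : ∀ᶠ z in cobounded ℂ ⊓ 𝓟 {z : ℂ | 0 ≤ z.im}, ‖z * G z‖ < ε / 5 := by
    simpa using (Metric.tendsto_nhds.1 hlim) (ε / 5) (by positivity)
  rw [eventually_inf_principal] at hev
  obtain ⟨M, hM⟩ : ∃ M : ℝ, ∀ z : ℂ, M ≤ ‖z‖ → 0 ≤ z.im → ‖z * G z‖ < ε / 5 := by
    rw [← comap_norm_atTop, eventually_comap, eventually_atTop] at hev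
    obtain ⟨M, hM⟩ := hev
    exact ⟨M, fun z hz => hM _ hz z rfl⟩
  filter_upwards [eventually_ge_atTop (max M 1)] with R hR
  have hR1 : 1 ≤ R := (le_max_right _ _).trans hR
  have hRM : M ≤ R := (le_max_left _ _).trans hR
  have hR0 : 0 < R := by linarith
  have hb : ∀ z : ℂ, R ≤ ‖z‖ → 0 ≤ z.im → ‖G z‖ ≤ ε / 5 / R := fun z h1 h2 => by
    have h3 := hM z (hRM.trans h1) h2
    rw [norm_mul] at h3
    rw [le_div_iff₀ hR0]
    nlinarith [norm_nonneg (G z)]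
  have hrect := integral_boundary_rect_eq_zero_of_continuousOn_of_differentiableOn G
    (-R : ℂ) (R + R * I : ℂ) (hc.mono ?_) (hd.mono ?_)
  rotate_left
  · intro z hz
    have := hz.2
    simp [uIcc_of_le hR0.le] at this
    exact this.1
  · intro z hz
    have := hz.2
    simp [hR0.le] at this
    exact this.1
  simp only [neg_re, ofReal_re, add_re, mul_re, I_re, mul_zero, ofReal_im, I_im, mul_one, sub_self,
    add_zero, neg_im, neg_zero, ofReal_zero, zero_mul, add_im, mul_im, zero_add, ofReal_neg,
    smul_eq_mul] at hrect
  have h1 : ‖∫ x : ℝ in (-R)..R, G (x + R * I)‖ ≤ ε / 5 / R * |R - -R| := by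
    refine intervalIntegral.norm_integral_le_of_norm_le_const fun x _ => hb _ ?_ ?_
    · refine le_trans ?_ (abs_im_le_norm _)
      simp [abs_of_pos hR0]
    · simpa using hR0.le
  have h2 : ∀ s : ℝ, |s| = R → ‖∫ y : ℝ in (0 : ℝ)..R, G (s + y * I)‖ ≤ ε / 5 / R * |R - 0| := by
    intro s hs
    refine intervalIntegral.norm_integral_le_of_norm_le_const fun y hy => hb _ ?_ ?_
    · refine le_trans ?_ (abs_re_le_norm _)
      simp [hs]
    · rw [uIoc_of_le hR0.le] at hy
      simpa using hy.1.le
  have h3 := h2 R (abs_of_pos hR0)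
  have h4 := h2 (-R) (by rw [abs_neg, abs_of_pos hR0])
  push_cast at h4
  have hw : ε / 5 / R * |R - -R| = 2 * (ε / 5) := by
    rw [abs_of_pos (by linarith)]; field_simp; ring
  have hw' : ε / 5 / R * |R - 0| = ε / 5 := by
    rw [abs_of_pos (by linarith)]; field_simp; ring
  rw [hw] at h1
  rw [hw'] at h3 h4
  set A := ∫ x : ℝ in (-R)..R, G (x + R * I)
  set B := ∫ y : ℝ in (0 : ℝ)..R, G (R + y * I)
  set C := ∫ y : ℝ in (0 : ℝ)..R, G (-R + y * I)
  rw [dist_zero_right]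
  have : ∫ x : ℝ in (-R)..R, G x = A - I * B + I * C := by linear_combination hrect
  rw [this]
  calc ‖A - I * B + I * C‖ ≤ ‖A‖ + ‖I * B‖ + ‖I * C‖ :=
        (norm_add_le _ _).trans (by gcongr; exact norm_sub_le _ _)
    _ < ε := by
      rw [norm_mul, norm_mul, norm_I]
      linarith

lemma hasFPowerSeriesAt_ofScalars {c : ℕ → ℂ} {f : ℂ → ℂ}
    (h : ∀ w : ℂ, ‖w‖ < 1 → HasSum (fun n => c n * w ^ n) (f w)) :
    HasFPowerSeriesAt f (.ofScalars ℂ c) 0 := by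
  refine HasFPowerSeriesOnBall.hasFPowerSeriesAt (r := 1) ⟨?_, by simp, fun {y} hy => ?_⟩
  · refine le_of_forall_lt_imp_le_of_dense fun r hr => ?_
    lift r to NNReal using hr.ne_top
    apply FormalMultilinearSeries.le_radius_of_summable
    have : ‖((r : ℝ) : ℂ)‖ < 1 := by simpa using hr
    simpa using (h (r : ℝ) this).summable.norm
  · rw [← ENNReal.coe_one, Metric.eball_coe, NNReal.coe_one, mem_ball_zero_iff] at hy
    simpa [mul_comm] using h y hy

lemma iteratedDeriv_zero_of_hasSum {c : ℕ → ℂ} {f : ℂ → ℂ}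
    (h : ∀ w : ℂ, ‖w‖ < 1 → HasSum (fun n => c n * w ^ n) (f w)) (n : ℕ) :
    iteratedDeriv n f 0 = n.factorial * c n := by
  have h1 := hasFPowerSeriesAt_ofScalars h
  have h2 := AnalyticAt.hasFPowerSeriesAt ⟨_, h1⟩
  have h3 : c n = iteratedDeriv n f 0 / n.factorial := by
    simpa using congr_arg (FormalMultilinearSeries.coeff · n) (h1.eq_formalMultilinearSeries h2)
  rw [h3, mul_div_cancel₀ _ (by exact_mod_cast n.factorial_ne_zero)]

/-- The function `log (1 + w) / w`, with its removable singularity filled in. -/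
noncomputable def logQuot (w : ℂ) : ℂ := if w = 0 then 1 else log (1 + w) / w

lemma hasSum_logQuot (w : ℂ) (hw : ‖w‖ < 1) :
    HasSum (fun n : ℕ => (-1) ^ n / (n + 1) * w ^ n) (logQuot w) := by
  rcases eq_or_ne w 0 with rfl | h0
  · convert hasSum_ite_eq (0 : ℕ) (1 : ℂ) using 2 with n
    · rcases n.eq_zero_or_pos with rfl | hn
      · simp
      · simp [hn.ne']
    · simp [logQuot]
  · have h := hasSum_taylorSeries_log hw
    rw [← hasSum_nat_add_iff' 1] at h
    rw [logQuot, if_neg h0]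
    convert! h.div_const w using 2 with n
    · have : (n + 1 : ℂ) ≠ 0 := by exact_mod_cast n.succ_ne_zero
      push_cast
      field_simp
      ring
    · simp

lemma logQuot_zero : logQuot 0 = 1 := if_pos rfl

lemma hasDerivAt_logQuot_zero : HasDerivAt logQuot (-1 / 2) 0 := by
  have h := (hasFPowerSeriesAt_ofScalars hasSum_logQuot).hasDerivAt
  convert! h using 1
  rw [FormalMultilinearSeries.ofScalars_apply_eq]
  norm_num

lemma tendsto_mul_exp_sub : Tendsto
    (fun z : ℂ => (z + 1) * (exp 1 - exp (z * log (1 + 1 / z)))) (cobounded ℂ) (𝓝 (exp 1 / 2)) := by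
  have h1 : HasDerivAt (fun w => exp (logQuot w)) (exp 1 * (-1 / 2)) 0 := by
    have := hasDerivAt_logQuot_zero.cexp
    rwa [logQuot_zero] at this
  have h2 := (hasDerivAt_iff_tendsto_slope.1 h1)
  have h3 : Tendsto (fun w : ℂ => -(1 + w) * slope (fun w => exp (logQuot w)) 0 w) (𝓝[≠] 0)
      (𝓝 (-(1 + 0) * (exp 1 * (-1 / 2)))) := by
    refine Tendsto.mul ?_ h2
    exact (Continuous.tendsto (by fun_prop) 0).mono_left nhdsWithin_le_nhds
  have h4 : Tendsto (fun z : ℂ => z⁻¹) (cobounded ℂ) (𝓝[≠] 0) := tendsto_inv₀_cobounded'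
  have h5 := h3.comp h4
  convert h5.congr' ?_ using 2
  · ring
  · have : ∀ᶠ z : ℂ in cobounded ℂ, z ≠ 0 := eventually_ne_cobounded 0
    filter_upwards [this] with z hz
    simp only [Function.comp, slope_def_field, sub_zero, logQuot, inv_eq_zero, hz,
      if_false, one_div, div_inv_eq_mul]
    simp only [if_true, mul_comm z]
    field_simp
    ring

/-- The continuous extension of `(z + 1) f_1(z)` to the closed upper half-plane. -/
noncomputable def numer (z : ℂ) : ℂ := (z + 1) * exp 1 - upperBranch z

lemma tendsto_numer :
    Tendsto numer (cobounded ℂ ⊓ 𝓟 {z | 0 ≤ z.im}) (𝓝 (exp 1 / 2)) := by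
  refine (tendsto_mul_exp_sub.mono_left inf_le_left).congr' ?_
  filter_upwards [mem_inf_of_left (eventually_cobounded_le_norm (E := ℂ) 2),
    mem_inf_of_right (mem_principal_self {z : ℂ | 0 ≤ z.im})] with z (hz : 2 ≤ ‖z‖) him
  rw [numer, upperBranch_eq him fun h => ?_]
  · ring
  · have : |z.re| = ‖z‖ := by
      rw [abs_re_eq_norm]; exact h
    by_contra! hcon
    have : |z.re| ≤ 1 := abs_le.2 ⟨by linarith, by linarith⟩
    linarith

lemma tendsto_div_add_cobounded (a : ℂ) :
    Tendsto (fun z : ℂ => z / (z + a)) (cobounded ℂ) (𝓝 1) := by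
  have h : Tendsto (fun z : ℂ => (1 + a * z⁻¹)⁻¹) (cobounded ℂ) (𝓝 (1 + a * 0)⁻¹) :=
    ((tendsto_inv₀_cobounded.const_mul a).const_add 1).inv₀ (by simp)
  simp only [mul_zero, add_zero, inv_one] at h
  refine h.congr' ?_
  filter_upwards [eventually_ne_cobounded 0] with z hz
  have : z + a = z * (1 + a * z⁻¹) := by field_simp
  rw [this, div_mul_cancel_left₀ hz]

lemma continuousOn_numer : ContinuousOn numer {z | 0 ≤ z.im} :=
  ContinuousOn.sub (by fun_prop) continuousOn_upperBranch

lemma differentiableAt_numer {z : ℂ} (hz : z ∈ slitPlane) : DifferentiableAt ℂ numer z :=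
  DifferentiableAt.sub (by fun_prop) (differentiableAt_upperBranch hz)

lemma add_I_ne_zero {z : ℂ} (hz : 0 ≤ z.im) : z + I ≠ 0 := fun h => by
  have := congr_arg im h
  simp at this
  linarith

lemma continuousOn_dslope_numer {t : ℝ} (ht : 0 < t) :
    ContinuousOn (dslope numer t) {z | 0 ≤ z.im} := by
  intro z hz
  rcases eq_or_ne z t with rfl | h
  · exact (continuousAt_dslope_same.2
      (differentiableAt_numer (ofReal_mem_slitPlane.2 ht))).continuousWithinAt
  · exact (continuousWithinAt_dslope_of_ne h).2 (continuousOn_numer z hz)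

lemma tendsto_integral_dslope_numer {t r : ℝ} (ht : 0 < t) (hr : numer t = r) :
    Tendsto (fun R : ℝ => ∫ x in (-R)..R, (dslope numer t x - (exp 1 / 2 - r) / (x + I)))
      atTop (𝓝 0) := by
  refine tendsto_intervalIntegral_of_isLittleO
    (G := fun z => dslope numer t z - (exp 1 / 2 - r) / (z + I)) ?_ ?_ ?_
  · exact (continuousOn_dslope_numer ht).sub
      (ContinuousOn.div (by fun_prop) (by fun_prop) fun z hz => add_I_ne_zero hz)
  · intro z (hz : 0 < z.im)
    refine DifferentiableAt.differentiableWithinAt (DifferentiableAt.sub ?_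
      (DifferentiableAt.div (by fun_prop) (by fun_prop) (add_I_ne_zero hz.le)))
    have h : z ≠ t := by
      rintro rfl
      simp at hz
    exact (differentiableAt_dslope_of_ne h).2
      (differentiableAt_numer (mem_slitPlane_iff.2 (Or.inr hz.ne')))
  · have h1 : Tendsto (fun z : ℂ => z / (z + -t) * (numer z - r) -
        (exp 1 / 2 - r) * (z / (z + I))) (cobounded ℂ ⊓ 𝓟 {z | 0 ≤ z.im})
        (𝓝 (1 * (exp 1 / 2 - r) - (exp 1 / 2 - r) * 1)) :=
      (((tendsto_div_add_cobounded _).mono_left inf_le_left).mul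
        (tendsto_numer.sub_const _)).sub
        (((tendsto_div_add_cobounded _).mono_left inf_le_left).const_mul _)
    rw [show (1 * (exp 1 / 2 - r) - (exp 1 / 2 - r) * 1 : ℂ) = 0 by ring] at h1
    refine h1.congr' ?_
    filter_upwards [mem_inf_of_left (eventually_ne_cobounded (t : ℂ))] with z (hz : z ≠ t)
    rw [dslope_of_ne _ hz, slope_def_field, hr]
    ring

lemma numer_ofReal_im (x : ℝ) : (numer x).im = -(upperBranch x).im := by
  have : (x + 1 : ℂ) * exp 1 = ((x + 1) * Real.exp 1 : ℝ) := by push_cast; rfl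
  rw [numer, sub_im, this, ofReal_im, zero_sub]

lemma im_dslope_numer {t r x : ℝ} (hr : numer t = r) (hx : x ≠ t) :
    (dslope numer t x).im = -(upperBranch x).im / (x - t) := by
  rw [dslope_of_ne _ (by exact_mod_cast hx), slope_def_field, hr, ← ofReal_sub, div_ofReal_im,
    sub_im, ofReal_im, sub_zero, numer_ofReal_im]

lemma im_div_add_I (k x : ℝ) : ((k : ℂ) / (x + I)).im = -k * (1 + x ^ 2)⁻¹ := by
  have h : normSq (x + I) = 1 + x ^ 2 := by simp [normSq_apply]; ring
  rw [div_im, h]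
  simp
  ring

lemma intervalIntegral_upperBranch {t R : ℝ} (ht : 0 < t) (hR : 1 ≤ R) :
    ∫ x in (-R)..R, -(upperBranch x).im / (x - t) =
      ∫ y in Ioo (0 : ℝ) 1, (1 - y) * density y / (y + t) := by
  have h1 : ∫ x in (-R)..R, -(upperBranch x).im / (x - t) =
      ∫ x in (-1 : ℝ)..0, -(upperBranch x).im / (x - t) := by
    rw [intervalIntegral.integral_of_le (by linarith), intervalIntegral.integral_of_le (by simp)]
    refine setIntegral_eq_of_subset_of_forall_sdiff_eq_zero measurableSet_Ioc
      (Ioc_subset_Ioc (by linarith) (by linarith)) fun x hx => ?_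
    have : (upperBranch x).im = 0 := by
      rcases le_or_gt x (-1) with h | h
      · exact upperBranch_ofReal_im_of_le h
      · refine upperBranch_ofReal_im_of_nonneg ?_
        by_contra! hcon
        exact hx.2 ⟨h, hcon.le⟩
    rw [this]; simp
  have h2 := intervalIntegral.integral_comp_neg
    (fun x : ℝ => -(upperBranch x).im / (x - t)) (a := 0) (b := 1)
  rw [neg_zero] at h2
  rw [h1, ← h2, intervalIntegral.integral_of_le zero_le_one, integral_Ioc_eq_integral_Ioo]
  refine setIntegral_congr_fun measurableSet_Ioo fun y hy => ?_
  have h3 : y + t ≠ 0 := by linarith [hy.1]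
  have h4 : -y - t ≠ 0 := by linarith [hy.1]
  rw [upperBranch_neg_im hy.1 hy.2, div_eq_div_iff h4 h3]
  ring

lemma integral_one_sub_mul_density {t r : ℝ} (ht : 0 < t) (hr : numer t = r) :
    ∫ y in Ioo (0 : ℝ) 1, (1 - y) * density y / (y + t) = Real.pi * (r - Real.exp 1 / 2) := by
  set J := ∫ y in Ioo (0 : ℝ) 1, (1 - y) * density y / (y + t) with hJ
  set k : ℝ := Real.exp 1 / 2 - r with hk
  have hk' : (exp 1 / 2 - r : ℂ) = (k : ℂ) := by rw [hk]; push_cast; rfl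
  have h1 := tendsto_integral_dslope_numer ht hr
  rw [hk'] at h1
  have h2 : Tendsto (fun R : ℝ => (∫ x in (-R)..R, (dslope numer t x - k / (x + I))).im)
      atTop (𝓝 0) := by
    exact (continuous_im.tendsto 0).comp h1
  have h3 : Tendsto (fun R : ℝ => J + k * (2 * Real.arctan R)) atTop
      (𝓝 (J + k * (2 * (Real.pi / 2)))) :=
    (((tendsto_nhds_of_tendsto_nhdsWithin
      Real.tendsto_arctan_atTop).const_mul 2).const_mul k).const_add J
  have h4 : (fun R : ℝ => J + k * (2 * Real.arctan R)) =ᶠ[atTop]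
      (fun R : ℝ => (∫ x in (-R)..R, (dslope numer t x - k / (x + I))).im) := by
    filter_upwards [eventually_ge_atTop 1] with R hR
    have hc1 : Continuous fun x : ℝ => dslope numer t x :=
      (continuousOn_dslope_numer ht).comp_continuous continuous_ofReal fun x => by simp
    have hc2 : Continuous fun x : ℝ => (k : ℂ) / (x + I) :=
      Continuous.div (by fun_prop) (by fun_prop) fun x => add_I_ne_zero (by simp)
    have him := imCLM.intervalIntegral_comp_comm
      ((hc1.sub hc2).intervalIntegrable (μ := volume) (-R) R)
    simp only [imCLM_apply, Pi.sub_apply, sub_im] at him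
    have hi1 : IntervalIntegrable (fun x : ℝ => (dslope numer t x).im) volume (-R) R :=
      (continuous_im.comp hc1).intervalIntegrable _ _
    have hi2 : IntervalIntegrable (fun x : ℝ => ((k : ℂ) / (x + I)).im) volume (-R) R :=
      (continuous_im.comp hc2).intervalIntegrable _ _
    rw [← him, intervalIntegral.integral_sub hi1 hi2]
    simp only [im_div_add_I]
    rw [intervalIntegral.integral_const_mul, integral_inv_one_add_sq, Real.arctan_neg, hJ,
      ← intervalIntegral_upperBranch ht hR]
    have hcongr : ∫ x in (-R)..R, (dslope numer t x).im =
        ∫ x in (-R)..R, -(upperBranch x).im / (x - t) := by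
      refine intervalIntegral.integral_congr_ae ?_
      filter_upwards [compl_mem_ae_iff.2 (measure_singleton t)] with x hx _
      exact im_dslope_numer hr hx
    rw [hcongr]
    ring
  have h5 := tendsto_nhds_unique (h3.congr' h4) h2
  linear_combination h5


lemma mem_segment_neg_one_zero {z : ℂ} :
    z ∈ segment ℝ (-1 : ℂ) 0 ↔ z.im = 0 ∧ -1 ≤ z.re ∧ z.re ≤ 0 := by
  have h := segment_eq_image ℝ (-1 : ℂ) 0
  rw [h]
  constructor
  · rintro ⟨θ, ⟨h0, h1⟩, rfl⟩
    simp only [smul_neg, smul_zero, add_zero, neg_im, neg_re, real_smul, mul_one, ofReal_im,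
      ofReal_re]
    refine ⟨by simp, by linarith, by linarith⟩
  · rintro ⟨h0, h1, h2⟩
    refine ⟨1 + z.re, ⟨by linarith, by linarith⟩, ?_⟩
    apply Complex.ext <;> simp [h0]

lemma isOpen_compl_segment : IsOpen (segment ℝ (-1 : ℂ) 0)ᶜ := by
  rw [isOpen_compl_iff, segment_eq_image]
  exact (isCompact_Icc.image (by fun_prop)).isClosed

lemma compl_segment_eq :
    (segment ℝ (-1 : ℂ) 0)ᶜ = slitPlane ∪ (fun z => -1 - z) ⁻¹' slitPlane := by
  ext z
  simp only [mem_compl_iff, mem_segment_neg_one_zero, mem_union, mem_preimage, mem_slitPlane_iff,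
    sub_re, sub_im, neg_re, neg_im, one_re, one_im]
  grind

lemma isPreconnected_compl_segment : IsPreconnected (segment ℝ (-1 : ℂ) 0)ᶜ := by
  rw [compl_segment_eq]
  have h := starConvex_one_slitPlane.isPathConnected one_mem_slitPlane
  have h2 : (fun z : ℂ => -1 - z) ⁻¹' slitPlane = (fun z => -1 - z) '' slitPlane := by
    ext z
    simp only [mem_preimage, mem_image]
    exact ⟨fun hz => ⟨_, hz, by ring⟩, by rintro ⟨w, hw, rfl⟩; simpa using hw⟩
  refine IsPreconnected.union I (by simp [mem_slitPlane_iff]) (by simp [mem_slitPlane_iff])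
    h.isConnected.isPreconnected ?_
  rw [h2]
  exact h.isConnected.isPreconnected.image _ (by fun_prop)

lemma one_add_inv_mem_slitPlane {z : ℂ} (hz : z ∉ segment ℝ (-1 : ℂ) 0) :
    1 + 1 / z ∈ slitPlane := by
  have h0 : z ≠ 0 := by
    rintro rfl
    exact hz (right_mem_segment ℝ _ _)
  rw [mem_segment_neg_one_zero] at hz
  rw [mem_slitPlane_iff]
  by_contra! h
  obtain ⟨h1, h2⟩ := h
  have hn := normSq_pos.2 h0
  simp only [one_div, add_re, add_im, one_re, one_im, inv_re, inv_im, zero_add] at h1 h2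
  rw [div_eq_zero_iff] at h2
  have h3 : z.im = 0 := by
    rcases h2 with h | h
    · linarith
    · exact absurd h hn.ne'
  have h4 : z.re ≠ 0 := fun h => h0 (Complex.ext h h3)
  have h5 : z.re / normSq z = z.re⁻¹ := by
    rw [normSq_apply, h3]
    field_simp
    simp
  rw [h5] at h1
  have h6 : z.re < 0 := by
    exact inv_lt_zero.1 (by linarith)
  refine hz ⟨h3, ?_, h6.le⟩
  have : z.re⁻¹ ≤ -1 := by linarith
  rw [inv_le_of_neg h6 (by norm_num)] at this
  simpa using this

lemma differentiableAt_bmpF {z : ℂ} (hz : z ∉ segment ℝ (-1 : ℂ) 0) :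
    DifferentiableAt ℂ (bmpF 1) z := by
  have h0 : z ≠ 0 := by
    rintro rfl
    exact hz (right_mem_segment ℝ _ _)
  have h1 := one_add_inv_mem_slitPlane hz
  unfold bmpF
  fun_prop (disch := assumption)

/-- The Cauchy transform of `density`. -/
noncomputable def cauchyTransform (z : ℂ) : ℂ :=
  ∫ x in Ioo (0 : ℝ) 1, (density x : ℂ) / (x + z)

lemma neg_mem_segment {x : ℝ} (hx : x ∈ Ioo (0 : ℝ) 1) : (-x : ℂ) ∈ segment ℝ (-1 : ℂ) 0 := by
  rw [mem_segment_neg_one_zero]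
  simp only [neg_im, ofReal_im, neg_zero, neg_re, ofReal_re, true_and]
  constructor <;> linarith [hx.1, hx.2]

lemma ofReal_add_ne_zero {x : ℝ} (hx : x ∈ Ioo (0 : ℝ) 1) {z : ℂ}
    (hz : z ∉ segment ℝ (-1 : ℂ) 0) : (x + z : ℂ) ≠ 0 := fun h => by
  rw [← neg_eq_of_add_eq_zero_right h] at hz
  exact hz (neg_mem_segment hx)

lemma measurable_density_div (z : ℂ) : Measurable fun x : ℝ => (density x : ℂ) / (x + z) :=
  (measurable_ofReal.comp measurable_density).div (measurable_ofReal.add_const z)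

lemma differentiableAt_cauchyTransform {z : ℂ} (hz : z ∉ segment ℝ (-1 : ℂ) 0) :
    DifferentiableAt ℂ cauchyTransform z := by
  obtain ⟨ε, hε, hball⟩ := Metric.isOpen_iff.1 isOpen_compl_segment z hz
  have key : ∀ x ∈ Ioo (0 : ℝ) 1, ∀ w ∈ Metric.ball z (ε / 2), ε / 2 ≤ ‖(x + w : ℂ)‖ := by
    intro x hx w hw
    have h1 : ε ≤ ‖(-x - z : ℂ)‖ := by
      by_contra! h
      exact hball (mem_ball_iff_norm.2 h) (neg_mem_segment hx)
    rw [mem_ball_iff_norm] at hw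
    have h2 : ‖(-x - z : ℂ)‖ ≤ ‖(x + w : ℂ)‖ + ‖w - z‖ := by
      rw [← norm_neg (x + w : ℂ)]
      calc ‖(-x - z : ℂ)‖ = ‖(-(x + w) + (w - z) : ℂ)‖ := by congr 1; ring
        _ ≤ _ := norm_add_le _ _
    linarith
  have hz2 : Metric.ball z (ε / 2) ∈ 𝓝 z := Metric.ball_mem_nhds _ (by positivity)
  have hsub : ∀ w ∈ Metric.ball z (ε / 2), w ∉ segment ℝ (-1 : ℂ) 0 := fun w hw =>
    hball (Metric.ball_subset_ball (by linarith) hw)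
  have hb : Integrable (fun _ : ℝ => Real.pi / (ε / 2) ^ 2) (volume.restrict (Ioo (0 : ℝ) 1)) :=
    integrable_const _
  have h := hasDerivAt_integral_of_dominated_loc_of_deriv_le (μ := volume.restrict (Ioo (0 : ℝ) 1))
    (F := fun w x => (density x : ℂ) / (x + w)) (F' := fun w x => -(density x : ℂ) / (x + w) ^ 2)
    (bound := fun _ => Real.pi / (ε / 2) ^ 2) hz2
    (.of_forall fun w => (measurable_density_div w).aestronglyMeasurable) ?_ ?_ ?_ hb ?_
  · exact h.2.differentiableAt
  · refine Integrable.mono' (g := fun _ => Real.pi / (ε / 2)) (integrable_const _)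
      (measurable_density_div z).aestronglyMeasurable ?_
    refine (ae_restrict_iff' measurableSet_Ioo).2 (.of_forall fun x hx => ?_)
    rw [norm_div, norm_real]
    exact div_le_div₀ Real.pi_pos.le (norm_density_le hx) (by positivity)
      (key x hx z (Metric.mem_ball_self (by positivity)))
  · exact ((measurable_ofReal.comp measurable_density).neg.div
      ((measurable_ofReal.add_const z).pow_const 2)).aestronglyMeasurable
  · refine (ae_restrict_iff' measurableSet_Ioo).2 (.of_forall fun x hx w hw => ?_)
    rw [norm_div, norm_neg, norm_real, norm_pow]
    exact div_le_div₀ Real.pi_pos.le (norm_density_le hx) (by positivity)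
      (pow_le_pow_left₀ (by positivity) (key x hx w hw) 2)
  · refine (ae_restrict_iff' measurableSet_Ioo).2 (.of_forall fun x hx w hw => ?_)
    have := ((hasDerivAt_id w).const_add (x : ℂ)).inv (ofReal_add_ne_zero hx (hsub w hw))
    convert! this.const_mul (density x : ℂ) using 1
    simp only [id]
    ring

lemma numer_eq {z : ℂ} (hz : 0 ≤ z.im) (hz' : z.im = 0 → z.re < -1 ∨ 0 < z.re) :
    numer z = (z + 1) * bmpF 1 z := by
  rw [numer, upperBranch_eq hz hz', bmpF, one_mul]
  ring

lemma bmpF_ofReal {t : ℝ} (ht : 0 < t) :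
    bmpF 1 t = (Real.exp 1 - Real.exp (t * Real.log (1 + 1 / t)) : ℝ) := by
  rw [bmpF]
  push_cast
  rw [ofReal_log (by positivity)]
  push_cast
  rw [one_mul]

lemma cauchyTransform_ofReal (t : ℝ) :
    cauchyTransform t = (∫ x in Ioo (0 : ℝ) 1, density x / (x + t) : ℝ) := by
  rw [cauchyTransform, ← integral_complex_ofReal]
  push_cast
  rfl

lemma exists_bmpF_ofReal_eq : ∃ c : ℂ, ∀ t : ℝ, 0 < t →
    bmpF 1 t = c / (t + 1) + (1 / Real.pi : ℝ) * cauchyTransform t := by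
  refine ⟨(Real.exp 1 / 2 + 1 / Real.pi * -∫ x in Ioo (0 : ℝ) 1, density x : ℝ), fun t ht => ?_⟩
  set F := Real.exp 1 - Real.exp (t * Real.log (1 + 1 / t)) with hF
  have h1 := numer_eq (z := t) (by simp) (by simp [ht])
  rw [bmpF_ofReal ht, ← hF] at h1
  have h2 := integral_one_sub_mul_density ht (r := (t + 1) * F) (by rw [h1]; push_cast; rfl)
  have hint : IntegrableOn (fun y => density y / (y + t)) (Ioo 0 1) := by
    refine Integrable.mono' (g := fun _ => Real.pi / t) (integrable_const _)
      (measurable_density.div (measurable_id.add_const t)).aestronglyMeasurable ?_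
    refine (ae_restrict_iff' measurableSet_Ioo).2 (.of_forall fun x hx => ?_)
    rw [norm_div, Real.norm_of_nonneg (add_pos hx.1 ht).le]
    exact div_le_div₀ Real.pi_pos.le (norm_density_le hx) ht (by linarith [hx.1])
  have h3 : ∫ y in Ioo (0 : ℝ) 1, (1 - y) * density y / (y + t) =
      (1 + t) * (∫ y in Ioo (0 : ℝ) 1, density y / (y + t)) - ∫ y in Ioo (0 : ℝ) 1, density y := by
    rw [← integral_const_mul, ← integral_sub (hint.const_mul _) integrableOn_density]
    refine setIntegral_congr_fun measurableSet_Ioo fun y hy => ?_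
    have : y + t ≠ 0 := (add_pos hy.1 ht).ne'
    field_simp
    ring
  rw [h3] at h2
  rw [bmpF_ofReal ht, cauchyTransform_ofReal, ← hF]
  norm_cast
  have hpi := Real.pi_ne_zero
  have : t + 1 ≠ 0 := by positivity
  field_simp
  linear_combination -2 * h2

lemma exists_bmpF_eq : ∃ c : ℂ, ∀ z ∉ segment ℝ (-1 : ℂ) 0,
    bmpF 1 z = c / (z + 1) + (1 / Real.pi : ℝ) * cauchyTransform z := by
  obtain ⟨c, hc⟩ := exists_bmpF_ofReal_eq
  refine ⟨c, ?_⟩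
  have h1 : AnalyticOnNhd ℂ (bmpF 1) (segment ℝ (-1 : ℂ) 0)ᶜ :=
    DifferentiableOn.analyticOnNhd
      (fun z hz => (differentiableAt_bmpF hz).differentiableWithinAt) isOpen_compl_segment
  have h2 : AnalyticOnNhd ℂ (fun z => c / (z + 1) + (1 / Real.pi : ℝ) * cauchyTransform z)
      (segment ℝ (-1 : ℂ) 0)ᶜ := by
    refine DifferentiableOn.analyticOnNhd (fun z hz => ?_) isOpen_compl_segment
    have h3 : z + 1 ≠ 0 := fun h => by
      rw [eq_neg_of_add_eq_zero_left h] at hz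
      exact hz (left_mem_segment ℝ _ _)
    have h4 := differentiableAt_cauchyTransform hz
    refine DifferentiableAt.differentiableWithinAt ?_
    fun_prop (disch := assumption)
  have h3 : ∃ᶠ z in 𝓝[≠] (1 : ℂ),
      bmpF 1 z = c / (z + 1) + (1 / Real.pi : ℝ) * cauchyTransform z := by
    have h4 : Tendsto (fun t : ℝ => (t : ℂ)) (𝓝[>] 1) (𝓝[≠] 1) := by
      refine tendsto_nhdsWithin_iff.2 ⟨?_, ?_⟩
      · exact (continuous_ofReal.tendsto' 1 1 (by simp)).mono_left nhdsWithin_le_nhds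
      · filter_upwards [self_mem_nhdsWithin] with t ht
        simpa using (ht : (1 : ℝ) < t).ne'
    refine h4.frequently (Eventually.frequently ?_)
    filter_upwards [self_mem_nhdsWithin] with t ht
    exact hc t (zero_lt_one.trans ht)
  exact h1.eqOn_of_preconnected_of_frequently_eq h2 isPreconnected_compl_segment
    (by simp [mem_segment_neg_one_zero]) h3

lemma tendsto_mul_cauchyTransform : Tendsto
    (fun ε : ℝ => (-1 + ε * I + 1) * cauchyTransform (-1 + ε * I)) (𝓝[>] 0) (𝓝 0) := by
  simp only [cauchyTransform, ← integral_const_mul]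
  have h : Tendsto (fun ε : ℝ => ∫ x in Ioo (0 : ℝ) 1,
      (-1 + ε * I + 1 : ℂ) * ((density x : ℂ) / (x + (-1 + ε * I)))) (𝓝[>] 0)
      (𝓝 (∫ x in Ioo (0 : ℝ) 1, (0 : ℂ))) := by
    refine tendsto_integral_filter_of_dominated_convergence (fun _ => Real.pi)
      (.of_forall fun ε => ((measurable_density_div _).const_mul _).aestronglyMeasurable) ?_
      (integrable_const _) ?_
    · filter_upwards [self_mem_nhdsWithin] with ε hε
      have hε : 0 < ε := hε
      refine (ae_restrict_iff' measurableSet_Ioo).2 (.of_forall fun x hx => ?_)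
      have h1 : ε ≤ ‖(x + (-1 + ε * I) : ℂ)‖ := by
        have := abs_im_le_norm (x + (-1 + ε * I) : ℂ)
        simpa [abs_of_pos hε] using this
      have h2 : ‖(-1 + ε * I + 1 : ℂ)‖ = ε := by
        rw [neg_add_cancel_comm, norm_mul, norm_I, norm_real, Real.norm_of_nonneg hε.le, mul_one]
      rw [norm_mul, norm_div, norm_real, h2, mul_div_assoc', div_le_iff₀ (hε.trans_le h1), mul_comm]
      exact mul_le_mul (norm_density_le hx) h1 hε.le Real.pi_pos.le
    · refine (ae_restrict_iff' measurableSet_Ioo).2 (.of_forall fun x hx => ?_)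
      have h0 : (x + (-1 + (0 : ℝ) * I) : ℂ) ≠ 0 := by
        have : x + -1 ≠ 0 := (by linarith [hx.2] : x + -1 < 0).ne
        simpa using ofReal_ne_zero.2 this
      have h1 : ContinuousAt (fun ε : ℝ => (-1 + ε * I + 1 : ℂ) *
          ((density x : ℂ) / (x + (-1 + ε * I)))) 0 := by
        fun_prop (disch := assumption)
      have h2 := h1.tendsto
      simp only [ofReal_zero, zero_mul, add_zero, neg_add_cancel] at h2
      exact h2.mono_left nhdsWithin_le_nhds
  simpa using h

theorem bmpF_one_eq {z : ℂ} (hz : z ∉ segment ℝ (-1 : ℂ) 0) :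
    bmpF 1 z = (z + 1)⁻¹ + (1 / Real.pi : ℝ) * cauchyTransform z := by
  obtain ⟨c, hc⟩ := exists_bmpF_eq
  have hmem : ∀ᶠ ε : ℝ in 𝓝[>] 0, numer (-1 + ε * I) =
      c + (1 / Real.pi : ℝ) * ((-1 + ε * I + 1) * cauchyTransform (-1 + ε * I)) := by
    filter_upwards [self_mem_nhdsWithin] with ε hε
    have hε : 0 < ε := hε
    rw [numer_eq (by simp [hε.le]) (by simp [hε.ne']), hc _ (by
      simp [mem_segment_neg_one_zero, hε.ne'])]
    have : (-1 + ε * I + 1 : ℂ) ≠ 0 := by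
      rw [neg_add_cancel_comm]
      simp [hε.ne']
    field_simp
  have h1 : Tendsto (fun ε : ℝ => numer (-1 + ε * I)) (𝓝[>] 0) (𝓝 (numer (-1))) := by
    have h2 := continuousOn_numer (-1) (by simp)
    refine h2.tendsto.comp (tendsto_nhdsWithin_iff.2 ⟨?_, ?_⟩)
    · exact (Continuous.tendsto' (by fun_prop) 0 (-1) (by simp)).mono_left nhdsWithin_le_nhds
    · filter_upwards [self_mem_nhdsWithin] with ε hε
      simpa using (show 0 < ε from hε).le
  have h2 := (tendsto_mul_cauchyTransform.const_mul ((1 / Real.pi : ℝ) : ℂ)).const_add c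
  have h3 := tendsto_nhds_unique (h1.congr' hmem) h2
  rw [numer, upperBranch_neg_one] at h3
  have hc1 : c = 1 := by simpa using h3.symm
  rw [hc z hz, hc1, one_div]

/-- The moments of the representing measure `δ₁ + density / π` on `(0, 1]`. -/
noncomputable def moment (n : ℕ) : ℝ :=
  1 + (1 / Real.pi) * ∫ x in Ioo (0 : ℝ) 1, density x * x ^ n

lemma hasSum_mul_moment {c : ℕ → ℂ} {g : ℝ → ℂ} (hc : Summable fun n => ‖c n‖)
    (hg : ∀ x ∈ Ioc (0 : ℝ) 1, HasSum (fun n => c n * (x : ℂ) ^ n) (g x)) :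
    HasSum (fun n => c n * moment n)
      (g 1 + (1 / Real.pi : ℝ) * ∫ x in Ioo (0 : ℝ) 1, (density x : ℂ) * g x) := by
  have h1 : HasSum (fun n => ∫ x in Ioo (0 : ℝ) 1, (density x : ℂ) * (c n * (x : ℂ) ^ n))
      (∫ x in Ioo (0 : ℝ) 1, (density x : ℂ) * g x) := by
    refine hasSum_integral_of_dominated_convergence (fun n _ => Real.pi * ‖c n‖)
      (fun n => ((measurable_ofReal.comp measurable_density).mul
        ((measurable_ofReal.pow_const n).const_mul (c n))).aestronglyMeasurable)
      (fun n => (ae_restrict_iff' measurableSet_Ioo).2 (.of_forall fun x hx => ?_))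
      (.of_forall fun _ => hc.mul_left _) (integrable_const _)
      ((ae_restrict_iff' measurableSet_Ioo).2 (.of_forall fun x hx =>
        (hg x (Ioo_subset_Ioc_self hx)).mul_left _))
    rw [norm_mul, norm_mul, norm_real, norm_pow, norm_real, Real.norm_of_nonneg hx.1.le]
    exact mul_le_mul (norm_density_le hx)
      (mul_le_of_le_one_right (norm_nonneg _) (pow_le_one₀ hx.1.le hx.2.le))
      (mul_nonneg (norm_nonneg _) (pow_nonneg hx.1.le n)) Real.pi_pos.le
  have h2 := (hg 1 (by simp)).add (h1.mul_left ((1 / Real.pi : ℝ) : ℂ))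
  refine h2.congr_fun fun n => ?_
  have h3 : ∫ x in Ioo (0 : ℝ) 1, (density x : ℂ) * (c n * (x : ℂ) ^ n) =
      c n * (∫ x in Ioo (0 : ℝ) 1, density x * x ^ n : ℝ) := by
    rw [← integral_complex_ofReal, ← integral_const_mul]
    refine integral_congr_ae (.of_forall fun x => ?_)
    push_cast
    ring
  rw [h3, moment]
  push_cast
  ring

lemma inv_notMem_segment {w : ℂ} (hw : ‖w‖ < 1) (h0 : w ≠ 0) :
    w⁻¹ ∉ segment ℝ (-1 : ℂ) 0 := fun h => by
  obtain ⟨h1, h2, h3⟩ := mem_segment_neg_one_zero.1 h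
  have h4 : ‖w⁻¹‖ ≤ 1 := by
    refine (norm_le_abs_re_add_abs_im _).trans ?_
    rw [h1, abs_zero, add_zero, abs_le]
    constructor <;> linarith
  rw [norm_inv] at h4
  exact absurd ((one_lt_inv₀ (norm_pos_iff.2 h0)).2 hw) h4.not_gt

/-- The Taylor coefficients of `exp (log (1 + w) / w)` at `0`. -/
noncomputable def expCoeff : ℕ → ℂ
  | 0 => exp 1
  | n + 1 => (-1) ^ (n + 1) * moment n

lemma hasSum_expCoeff (w : ℂ) (hw : ‖w‖ < 1) :
    HasSum (fun n => expCoeff n * w ^ n) (exp (logQuot w)) := by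
  rcases eq_or_ne w 0 with rfl | h0
  · rw [logQuot_zero]
    convert! hasSum_single (f := fun n => expCoeff n * (0 : ℂ) ^ n) 0 fun n hn => by simp [hn]
      using 1
    simp [expCoeff]
  have hc : Summable fun n : ℕ => ‖(-1) ^ n * w ^ (n + 1)‖ := by
    simp only [norm_mul, norm_pow, norm_neg, norm_one, one_pow, one_mul, pow_succ]
    exact (summable_geometric_of_lt_one (norm_nonneg _) hw).mul_right _
  have hg : ∀ x ∈ Ioc (0 : ℝ) 1,
      HasSum (fun n => (-1) ^ n * w ^ (n + 1) * (x : ℂ) ^ n) ((x + w⁻¹ : ℂ)⁻¹) := by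
    intro x hx
    have h1 : ‖-(x * w)‖ < 1 := by
      rw [norm_neg, norm_mul, norm_real, Real.norm_of_nonneg hx.1.le]
      exact (mul_le_of_le_one_left (norm_nonneg _) hx.2).trans_lt hw
    convert! (hasSum_geometric_of_norm_lt_one h1).mul_left w using 1
    · ext n
      rw [neg_pow]
      ring
    · rw [sub_neg_eq_add, ← inv_inv w, ← mul_inv, inv_inv]
      congr 1
      field_simp
      ring
  have h1 := hasSum_mul_moment hc hg
  have h2 := bmpF_one_eq (inv_notMem_segment hw h0)
  have h3 : bmpF 1 w⁻¹ = exp 1 - exp (logQuot w) := by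
    rw [bmpF, logQuot, if_neg h0, one_mul, one_div, inv_inv, inv_mul_eq_div]
  simp only [← div_eq_mul_inv, ofReal_one, add_comm (1 : ℂ)] at h1
  rw [← cauchyTransform, ← h2, h3] at h1
  rw [← hasSum_nat_add_iff' 1]
  convert! h1.neg using 1
  · ext n
    rw [expCoeff]
    ring
  · simp [expCoeff]

lemma deriv_exp_logQuot :
    deriv (fun w => exp (logQuot w)) =ᶠ[𝓝 0] deriv logQuot * fun w => exp (logQuot w) := by
  have h := (hasFPowerSeriesAt_ofScalars hasSum_logQuot).analyticAt
  filter_upwards [h.eventually_analyticAt] with w hw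
  rw [deriv_cexp hw.differentiableAt, Pi.mul_apply, mul_comm]

lemma expCoeff_succ (n : ℕ) : (n + 1 : ℂ) * expCoeff (n + 1) =
    ∑ k ∈ Finset.range (n + 1), (k + 1 : ℂ) * ((-1) ^ (k + 1) / (k + 2)) * expCoeff (n - k) := by
  have hL := (hasFPowerSeriesAt_ofScalars hasSum_logQuot).analyticAt
  have hE := (hasFPowerSeriesAt_ofScalars hasSum_expCoeff).analyticAt
  have h1 := iteratedDeriv_zero_of_hasSum hasSum_expCoeff (n + 1)
  rw [iteratedDeriv_succ', deriv_exp_logQuot.iteratedDeriv_eq n,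
    iteratedDeriv_mul hL.deriv.contDiffAt hE.contDiffAt] at h1
  have hn : (n.factorial : ℂ) ≠ 0 := by exact_mod_cast n.factorial_ne_zero
  apply mul_left_cancel₀ hn
  rw [Nat.factorial_succ] at h1
  push_cast at h1
  rw [← mul_assoc, mul_comm (n.factorial : ℂ), ← h1, Finset.mul_sum]
  refine Finset.sum_congr rfl fun k hk => ?_
  rw [← iteratedDeriv_succ', iteratedDeriv_zero_of_hasSum hasSum_logQuot,
    iteratedDeriv_zero_of_hasSum hasSum_expCoeff,
    ← Nat.choose_mul_factorial_mul_factorial (Finset.mem_range_succ_iff.1 hk), Nat.factorial_succ]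
  push_cast
  ring

lemma expCoeff_eq (n : ℕ) : expCoeff n = (Real.exp 1 * ((-1) ^ n * bmpP 1 n) : ℝ) := by
  induction n using Nat.strong_induction_on with
  | _ n ih =>
    rcases n with _ | n
    · simp [expCoeff, bmpP]
    · have hn : (n + 1 : ℂ) ≠ 0 := by exact_mod_cast n.succ_ne_zero
      apply mul_left_cancel₀ hn
      rw [expCoeff_succ, bmpP]
      push_cast
      rw [Finset.mul_sum, Finset.mul_sum, Finset.mul_sum, Finset.mul_sum]
      refine Finset.sum_congr rfl fun k hk => ?_
      have hk' := Finset.mem_range_succ_iff.1 hk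
      obtain ⟨m, rfl⟩ := Nat.exists_eq_add_of_le hk'
      rw [ih _ (by omega), Nat.add_sub_cancel_left]
      push_cast at hn ⊢
      field_simp
      ring

lemma exp_mul_bmpP_succ (n : ℕ) : Real.exp 1 * bmpP 1 (n + 1) = moment n := by
  have h : (-1) ^ (n + 1) * moment n = Real.exp 1 * ((-1) ^ (n + 1) * bmpP 1 (n + 1)) := by
    rw [← ofReal_inj, ← expCoeff_eq, expCoeff]
    push_cast
    rfl
  have h1 : ((-1 : ℝ) ^ (n + 1)) ≠ 0 := by simp
  apply mul_left_cancel₀ h1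
  rw [h]
  ring

theorem bmpPhiR_one_eq (s : ℝ) : bmpPhiR 1 s = Real.exp (-s) + (1 / Real.pi) *
    ∫ x in Ioo (0 : ℝ) 1, density x * Real.exp (-s * x) := by
  have hg : ∀ x : ℝ, HasSum (fun n : ℕ => ((-s : ℂ) ^ n / n.factorial) * (x : ℂ) ^ n)
      ((Real.exp (-s * x) : ℝ) : ℂ) := fun x => by
    have h := NormedSpace.expSeries_div_hasSum_exp (-s * x : ℂ)
    rw [← exp_eq_exp_ℂ] at h
    push_cast
    convert! h using 2 with n
    rw [mul_pow]
    ring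
  have hc : Summable fun n : ℕ => ‖(-s : ℂ) ^ n / n.factorial‖ := by
    simpa using NormedSpace.norm_expSeries_div_summable (-s : ℂ)
  have h1 := hasSum_mul_moment hc fun x _ => hg x
  have h2 : HasSum (fun n : ℕ => (-s) ^ n / n.factorial * moment n) (Real.exp (-s) +
      (1 / Real.pi) * ∫ x in Ioo (0 : ℝ) 1, density x * Real.exp (-s * x)) := by
    rw [← hasSum_ofReal]
    push_cast [← integral_complex_ofReal]
    simpa using h1
  rw [bmpPhiR, ← h2.tsum_eq, ← tsum_mul_left]
  refine tsum_congr fun n => ?_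
  rw [← exp_mul_bmpP_succ, neg_pow s]
  ring

end BinomialMean

/-- `φ_1(s) = e^{−s} + (1/π)∫_0^1 (x/(1−x))^x sin(πx) e^{−sx} dx` for `s ≥ 0`, and
`f_1(z) = (z+1)⁻¹ + (1/π)∫_0^1 (x/(1−x))^x sin(πx)/(x+z) dx` for `z ∉ [−1,0]`. -/
theorem stmt8 :
    (∀ s : ℝ, 0 ≤ s → bmpPhiR 1 s = Real.exp (-s) + (1 / Real.pi) *
      ∫ x in Set.Ioo (0 : ℝ) 1,
        (x / (1 - x)) ^ x * Real.sin (Real.pi * x) * Real.exp (-s * x)) ∧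
    (∀ z : ℂ, z ∉ segment ℝ (-1 : ℂ) 0 →
      bmpF 1 z = (z + 1)⁻¹ + (1 / Real.pi : ℝ) * ∫ x in Set.Ioo (0 : ℝ) 1,
        (((x / (1 - x)) ^ x * Real.sin (Real.pi * x) : ℝ) : ℂ) / ((x : ℂ) + z)) := by
  exact ⟨fun s _ => BinomialMean.bmpPhiR_one_eq s, fun z hz => BinomialMean.bmpF_one_eq hz⟩
end

section
/- Let α > 1. Then the function f_α : (0,∞) → ℝ, f_α(x) = e^α − (1+1/x)^{αx}, is not a Stieltjes function: there exist no a ≥ 0 and positive measure μ on [0,∞) with ∫ (1+t)^{−1} dμ(t) < ∞ such that f_α(x) = a + ∫_{[0,∞)} (x+t)^{−1} dμ(t) for all x > 0. -/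
open MeasureTheory Set

/-- A Stieltjes function: `f(x) = a + ∫_{[0,∞)} (x+t)⁻¹ dμ(t)` with `a ≥ 0` and `μ` a positive
measure on `[0,∞)` such that `∫ (1+t)⁻¹ dμ(t) < ∞`. -/
def IsStieltjesFun (f : ℝ → ℝ) : Prop :=
  ∃ (a : ℝ) (μ : MeasureTheory.Measure ℝ), 0 ≤ a ∧ μ (Set.Iio 0) = 0 ∧
    MeasureTheory.Integrable (fun t : ℝ => (1 + t)⁻¹) μ ∧
    ∀ x : ℝ, 0 < x → f x = a + ∫ t, (x + t)⁻¹ ∂μ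

/-- Points of the slit plane keep a distance from `-t`, `t ≥ 0`, comparable to `1 + t`. -/
lemma exists_mul_one_add_le_norm_add {z : ℂ} (hz : z ∈ Complex.slitPlane) :
    ∃ c : ℝ, 0 < c ∧ ∀ t : ℝ, 0 ≤ t → c * (1 + t) ≤ ‖z + t‖ := by
  obtain ⟨m, hm, h⟩ : ∃ m : ℝ, 0 < m ∧ ∀ t : ℝ, 0 ≤ t → m ≤ ‖z + t‖ := by
    rcases Complex.mem_slitPlane_iff.1 hz with h | h
    · refine ⟨z.re, h, fun t ht => ?_⟩
      have := Complex.re_le_norm (z + t)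
      simp at this
      linarith
    · refine ⟨|z.im|, abs_pos.2 h, fun t _ => ?_⟩
      simpa using Complex.abs_im_le_norm (z + t)
  have hD : 0 < 1 + ‖1 - z‖ / m := by positivity
  refine ⟨(1 + ‖1 - z‖ / m)⁻¹, inv_pos.2 hD, fun t ht => ?_⟩
  rw [inv_mul_le_iff₀ hD]
  have h1 : 1 + t ≤ ‖1 - z‖ + ‖z + t‖ := by
    have := norm_add_le (1 - z) (z + t)
    rw [show 1 - z + (z + t) = ((1 + t : ℝ) : ℂ) by push_cast; ring, Complex.norm_real,
      Real.norm_of_nonneg (by linarith)] at this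
    exact this
  have h2 : ‖1 - z‖ ≤ ‖1 - z‖ / m * ‖z + t‖ := by
    rw [div_mul_eq_mul_div, le_div_iff₀ hm]
    exact mul_le_mul_of_nonneg_left (h t ht) (norm_nonneg _)
  linarith

lemma norm_inv_le_of_mul_le {w : ℂ} {c t : ℝ} (hc : 0 < c) (ht : 0 ≤ t)
    (h : c * (1 + t) ≤ ‖w‖) : ‖w⁻¹‖ ≤ c⁻¹ * (1 + t)⁻¹ := by
  rw [norm_inv, ← mul_inv]
  exact inv_anti₀ (by positivity) h

/-- The Stieltjes transform of a measure on `[0,∞)` is holomorphic in the slit plane. -/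
lemma differentiableOn_stieltjes_transform {μ : Measure ℝ} (hμ : ∀ᵐ t ∂μ, 0 ≤ t)
    (hi : Integrable (fun t : ℝ => (1 + t)⁻¹) μ) :
    DifferentiableOn ℂ (fun z : ℂ => ∫ t, (z + (t : ℂ))⁻¹ ∂μ) Complex.slitPlane := by
  intro z hz
  obtain ⟨c, hc, h⟩ := exists_mul_one_add_le_norm_add hz
  have hball : ∀ w ∈ Metric.ball z (c / 2), ∀ t : ℝ, 0 ≤ t →
      c / 2 * (1 + t) ≤ ‖w + t‖ := by
    intro w hw t ht
    have h1 := norm_sub_le (w + t) (w - z)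
    rw [show w + t - (w - z) = z + t by ring] at h1
    have h2 : ‖w - z‖ < c / 2 := by simpa [dist_eq_norm] using hw
    nlinarith [h t ht]
  have hmeas : ∀ w : ℂ, AEStronglyMeasurable (fun t : ℝ => (w + (t : ℂ))⁻¹) μ := fun w =>
    (by fun_prop : Measurable (fun t : ℝ => (w + (t : ℂ))⁻¹)).aestronglyMeasurable
  have hint : Integrable (fun t : ℝ => (z + (t : ℂ))⁻¹) μ := by
    refine (hi.const_mul c⁻¹).mono' (hmeas z) ?_
    filter_upwards [hμ] with t ht
    exact norm_inv_le_of_mul_le hc ht (h t ht)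
  have key := hasDerivAt_integral_of_dominated_loc_of_deriv_le (μ := μ) (𝕜 := ℂ)
    (F := fun w t => (w + ((t : ℝ) : ℂ))⁻¹) (F' := fun w t => -1 / (w + ((t : ℝ) : ℂ)) ^ 2)
    (x₀ := z) (s := Metric.ball z (c / 2)) (bound := fun t => (c / 2)⁻¹ ^ 2 * (1 + t)⁻¹)
    (Metric.ball_mem_nhds z (by positivity)) (Filter.Eventually.of_forall hmeas) hint
    (by fun_prop : Measurable fun t : ℝ => -1 / (z + (t : ℂ)) ^ 2).aestronglyMeasurable
    ?_ (hi.const_mul _) ?_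
  · exact key.2.differentiableAt.differentiableWithinAt
  · filter_upwards [hμ] with t ht w hw
    have h1 := norm_inv_le_of_mul_le (by positivity) ht (hball w hw t ht)
    have h2 : (1 + t)⁻¹ ≤ 1 := inv_le_one_of_one_le₀ (by linarith)
    have h3 : 0 < (1 + t)⁻¹ := by positivity
    calc ‖-1 / (w + (t : ℂ)) ^ 2‖ = ‖(w + (t : ℂ))⁻¹‖ ^ 2 := by
          simp [norm_pow, inv_pow]
      _ ≤ ((c / 2)⁻¹ * (1 + t)⁻¹) ^ 2 := by gcongr
      _ = (c / 2)⁻¹ ^ 2 * ((1 + t)⁻¹ * (1 + t)⁻¹) := by ring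
      _ ≤ (c / 2)⁻¹ ^ 2 * (1 + t)⁻¹ := by
          gcongr
          nlinarith
  · filter_upwards [hμ] with t ht w hw
    have hne : w + (t : ℂ) ≠ 0 := by
      rw [← norm_pos_iff]
      exact lt_of_lt_of_le (by positivity) (hball w hw t ht)
    exact ((hasDerivAt_id w).add_const (t : ℂ)).inv hne

lemma one_add_inv_mem_slitPlane {z : ℂ} (hz : z ∈ Complex.slitPlane) :
    1 + z⁻¹ ∈ Complex.slitPlane := by
  have hn : 0 < Complex.normSq z := Complex.normSq_pos.2 (Complex.slitPlane_ne_zero hz)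
  rw [Complex.mem_slitPlane_iff] at hz ⊢
  rcases hz with h | h
  · left
    simp only [Complex.add_re, Complex.one_re, Complex.inv_re]
    positivity
  · right
    simp [Complex.inv_im, h, hn.ne']

/-- A Stieltjes representation of `f_α` persists in the slit plane. -/
lemma eqOn_slitPlane_of_stieltjes {α a : ℝ} {μ : Measure ℝ} (hμ : ∀ᵐ t ∂μ, 0 ≤ t)
    (hi : Integrable (fun t : ℝ => (1 + t)⁻¹) μ)
    (hf : ∀ x : ℝ, 0 < x →
      Real.exp α - (1 + 1 / x) ^ (α * x) = a + ∫ t, (x + t)⁻¹ ∂μ) :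
    EqOn (fun z : ℂ => Complex.exp α - Complex.exp (α * (z * Complex.log (1 + z⁻¹))))
      (fun z : ℂ => a + ∫ t, (z + (t : ℂ))⁻¹ ∂μ) Complex.slitPlane := by
  have hd : DifferentiableOn ℂ
      (fun z : ℂ => Complex.exp α - Complex.exp (α * (z * Complex.log (1 + z⁻¹))))
      Complex.slitPlane := by
    intro z hz
    have h0 := Complex.slitPlane_ne_zero hz
    have h1 := one_add_inv_mem_slitPlane hz
    have hl : DifferentiableAt ℂ (fun z : ℂ => Complex.log (1 + z⁻¹)) z :=
      ((differentiableAt_inv h0).const_add 1).clog h1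
    exact (((differentiableAt_id.mul hl).const_mul (α : ℂ)).cexp.const_sub _
      ).differentiableWithinAt
  have hd' := (differentiableOn_stieltjes_transform hμ hi).const_add (a : ℂ)
  refine (hd.analyticOnNhd Complex.isOpen_slitPlane).eqOn_of_preconnected_of_frequently_eq
    (hd'.analyticOnNhd Complex.isOpen_slitPlane)
    (Complex.starConvex_one_slitPlane.isPathConnected
      Complex.one_mem_slitPlane).isConnected.isPreconnected
    Complex.one_mem_slitPlane ?_
  have ht : Filter.Tendsto (fun x : ℝ => (x : ℂ)) (nhdsWithin 1 (Ioi 1))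
      (nhdsWithin (1 : ℂ) {1}ᶜ) := by
    refine tendsto_nhdsWithin_iff.2 ⟨?_, ?_⟩
    · simpa using (Complex.continuous_ofReal.tendsto 1).mono_left nhdsWithin_le_nhds
    · filter_upwards [self_mem_nhdsWithin] with x hx
      have : x ≠ 1 := ne_of_gt hx
      simpa using this
  refine ht.frequently (Filter.Eventually.frequently ?_)
  filter_upwards [self_mem_nhdsWithin] with x hx
  have hx0 : 0 < x := zero_lt_one.trans hx
  have hp : 0 < 1 + x⁻¹ := by positivity
  have h := congrArg (fun y : ℝ => (y : ℂ)) (hf x hx0)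
  rw [one_div, Real.rpow_def_of_pos hp] at h
  simp only [Complex.ofReal_sub, Complex.ofReal_add, Complex.ofReal_exp, Complex.ofReal_mul,
    Complex.ofReal_log hp.le, ← integral_complex_ofReal, Complex.ofReal_inv,
    Complex.ofReal_one] at h
  rw [← h]
  ring_nf

lemma le_norm_exp_mul_log_near_neg_one {α y : ℝ} (hα : 0 ≤ α) (hy : 0 < y) (hy1 : y ≤ 1) :
    Real.exp (-α * Real.log y - α * Real.pi) ≤
      ‖Complex.exp (α * ((-1 + y * Complex.I) *
        Complex.log (1 + (-1 + y * Complex.I : ℂ)⁻¹)))‖ := by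
  set z : ℂ := -1 + y * Complex.I with hz
  have hzs : z ∈ Complex.slitPlane := by
    rw [Complex.mem_slitPlane_iff]; right; simp [hz, hy.ne']
  have hz0 := Complex.slitPlane_ne_zero hzs
  have hw0 : 1 + z⁻¹ ≠ 0 := Complex.slitPlane_ne_zero (one_add_inv_mem_slitPlane hzs)
  have hz1 : 1 ≤ ‖z‖ := by simpa [hz] using Complex.abs_re_le_norm z
  have hw : ‖1 + z⁻¹‖ ≤ y := by
    have : 1 + z⁻¹ = y * Complex.I * z⁻¹ := by
      field_simp
      simp [hz]
    rw [this]
    simp only [norm_mul, Complex.norm_real, Complex.norm_I, norm_inv, Real.norm_of_nonneg hy.le,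
      mul_one]
    exact mul_le_of_le_one_right hy.le (inv_le_one_of_one_le₀ hz1)
  have hlog : Real.log ‖1 + z⁻¹‖ ≤ Real.log y := Real.log_le_log (norm_pos_iff.2 hw0) hw
  have harg := Complex.arg_le_pi (1 + z⁻¹)
  rw [Complex.norm_exp, Complex.re_ofReal_mul, Complex.mul_re, Complex.log_re, Complex.log_im]
  have hre : z.re = -1 := by simp [hz]
  have him : z.im = y := by simp [hz]
  rw [hre, him]
  apply Real.exp_le_exp.2
  have h1 : y * (1 + z⁻¹).arg ≤ Real.pi :=
    (mul_le_mul_of_nonneg_left harg hy.le).trans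
      (mul_le_of_le_one_left Real.pi_pos.le hy1)
  nlinarith

lemma norm_stieltjes_near_neg_one_le {μ : Measure ℝ} (hμ : ∀ᵐ t ∂μ, 0 ≤ t)
    (hi : Integrable (fun t : ℝ => (1 + t)⁻¹) μ) {y : ℝ} (hy : 0 < y) (hy1 : y ≤ 1) :
    ‖∫ t, (-1 + y * Complex.I + (t : ℂ))⁻¹ ∂μ‖ ≤ 3 / y * ∫ t, (1 + t)⁻¹ ∂μ := by
  rw [← integral_const_mul]
  refine norm_integral_le_of_norm_le (hi.const_mul _) ?_
  filter_upwards [hμ] with t ht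
  rw [show 3 / y = (y / 3)⁻¹ by rw [inv_div]]
  refine norm_inv_le_of_mul_le (by positivity) ht ?_
  have h1 := Complex.abs_im_le_norm (-1 + y * Complex.I + (t : ℂ))
  have h2 := Complex.re_le_norm (-1 + y * Complex.I + (t : ℂ))
  simp [abs_of_pos hy] at h1 h2
  nlinarith

/-- For `α > 1`, `f_α(x) = e^α − (1+1/x)^{αx}` is not a Stieltjes function. -/
theorem stmt9 (α : ℝ) (hα : 1 < α) :
    ¬ IsStieltjesFun (fun x : ℝ => Real.exp α - (1 + 1 / x) ^ (α * x)) := by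
  rintro ⟨a, μ, ha, hμ0, hi, hf⟩
  have hμ : ∀ᵐ t ∂μ, 0 ≤ t := by
    rw [ae_iff]
    simpa [Iio] using hμ0
  have hC : 0 ≤ ∫ t, (1 + t)⁻¹ ∂μ := by
    refine integral_nonneg_of_ae ?_
    filter_upwards [hμ] with t ht
    simp only [Pi.zero_apply]
    positivity
  set C := ∫ t, (1 + t)⁻¹ ∂μ
  set K := Real.exp α + a + 3 * C with hK
  have hK0 : 0 < K := by positivity
  set L := K * Real.exp (α * Real.pi) / (α - 1) with hL
  have hα' : 0 < α - 1 := by linarith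
  have hL0 : 0 < L := by positivity
  set y := Real.exp (-L) with hy
  have hy0 : 0 < y := Real.exp_pos _
  have hy1 : y ≤ 1 := Real.exp_le_one_iff.2 (by linarith)
  have hzs : (-1 + y * Complex.I : ℂ) ∈ Complex.slitPlane := by
    rw [Complex.mem_slitPlane_iff]; right; simp [hy0.ne']
  have heq := eqOn_slitPlane_of_stieltjes hμ hi hf hzs
  have hlow := le_norm_exp_mul_log_near_neg_one (by linarith : 0 ≤ α) hy0 hy1
  have hup := norm_stieltjes_near_neg_one_le hμ hi hy0 hy1
  simp only at heq
  rw [sub_eq_iff_eq_add', ← sub_eq_iff_eq_add] at heq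
  rw [← heq] at hlow
  have h1 := norm_sub_le (Complex.exp α)
    (a + ∫ t, (-1 + y * Complex.I + (t : ℂ))⁻¹ ∂μ)
  have h2 := norm_add_le (a : ℂ) (∫ t, (-1 + y * Complex.I + (t : ℂ))⁻¹ ∂μ)
  have h3 : ‖Complex.exp α‖ = Real.exp α := by simp [Complex.norm_exp]
  have h4 : ‖(a : ℂ)‖ = a := by simp [abs_of_nonneg ha]
  have hinv : 1 ≤ y⁻¹ := (one_le_inv₀ hy0).2 hy1
  have hbound : Real.exp (α * L - α * Real.pi) ≤ K * Real.exp L := by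
    have e1 : -α * Real.log y - α * Real.pi = α * L - α * Real.pi := by
      rw [hy, Real.log_exp]; ring
    have e2 : Real.exp L = y⁻¹ := by rw [hy, Real.exp_neg, inv_inv]
    rw [e1] at hlow
    rw [e2]
    rw [div_eq_mul_inv] at hup
    have h5 : Real.exp α + a ≤ (Real.exp α + a) * y⁻¹ :=
      le_mul_of_one_le_right (by positivity) hinv
    nlinarith
  have h6 : Real.exp ((α - 1) * L) ≤ K * Real.exp (α * Real.pi) := by
    have h7 := mul_le_mul_of_nonneg_right hbound (Real.exp_pos (α * Real.pi - L)).le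
    rw [← Real.exp_add, mul_assoc, ← Real.exp_add] at h7
    rwa [show α * L - α * Real.pi + (α * Real.pi - L) = (α - 1) * L by ring,
      show L + (α * Real.pi - L) = α * Real.pi by ring] at h7
  have h8 : (α - 1) * L = K * Real.exp (α * Real.pi) := by
    rw [hL]; field_simp
  linarith [Real.add_one_le_exp ((α - 1) * L)]
end

section
/- For 0 < α < 1 and every integer n ≥ 0, p_{n+1}(α) = (e^{−α}/π) ∫_0^1 (x/(1−x))^{αx} sin(απx) x^n dx, while for α = 1, p_{n+1}(1) = e^{−1} + (e^{−1}/π) ∫_0^1 (x/(1−x))^{x} sin(πx) x^n dx. In particular, for every 0 < α ≤ 1, the sequence (p_{n+1}(α))_{n≥0} is a Hausdorff moment sequence. -/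
open MeasureTheory Filter Set Asymptotics

/-- A power series with coefficients bounded by one is summable on the unit disc. -/
lemma summable_norm_mul_pow_of_norm_le_one {a : ℕ → ℂ} (ha : ∀ k, ‖a k‖ ≤ 1) {z : ℂ}
    (hz : ‖z‖ < 1) : Summable fun k => ‖a k * z ^ k‖ := by
  refine (summable_geometric_of_lt_one (norm_nonneg z) hz).of_nonneg_of_le
    (fun _ => norm_nonneg _) fun k => ?_
  rw [norm_mul, norm_pow]
  exact mul_le_of_le_one_left (by positivity) (ha k)

/-- Termwise differentiation of a power series with coefficients bounded by one. -/
lemma hasDerivAt_tsum_mul_pow {a : ℕ → ℂ} (ha : ∀ k, ‖a k‖ ≤ 1) {z : ℂ} (hz : ‖z‖ < 1) :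
    HasDerivAt (fun z => ∑' k, a k * z ^ k) (∑' k : ℕ, ((k + 1 : ℕ) : ℂ) * a (k + 1) * z ^ k) z := by
  obtain ⟨r, hzr, hr⟩ := exists_between hz
  have hr0 : 0 ≤ r := (norm_nonneg z).trans hzr.le
  have hsum : Summable fun k : ℕ => (k : ℝ) * r ^ (k - 1) := by
    rw [← summable_nat_add_iff 1]
    have h1 := summable_pow_mul_geometric_of_norm_lt_one (R := ℝ) 1 (r := r)
      (by rwa [Real.norm_of_nonneg hr0])
    have h2 := summable_geometric_of_lt_one hr0 hr
    refine (h1.add h2).congr fun k => ?_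
    push_cast
    simp
    ring
  have hbound : ∀ (k : ℕ), ∀ y ∈ Metric.ball (0 : ℂ) r,
      ‖a k * (k * y ^ (k - 1))‖ ≤ (k : ℝ) * r ^ (k - 1) := by
    intro k y hy
    rw [mem_ball_zero_iff] at hy
    rw [norm_mul, norm_mul, norm_pow, Complex.norm_natCast]
    refine (mul_le_of_le_one_left (by positivity) (ha k)).trans ?_
    gcongr
  have hz' : z ∈ Metric.ball (0 : ℂ) r := by simpa using hzr
  have key := hasDerivAt_tsum_of_isPreconnected (g := fun k z => a k * z ^ k)
    (g' := fun k z => a k * (k * z ^ (k - 1))) hsum Metric.isOpen_ball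
    (convex_ball (0 : ℂ) r).isPreconnected
    (fun k y _ => by simpa using (hasDerivAt_pow k y).const_mul (a k)) hbound hz'
    (summable_norm_mul_pow_of_norm_le_one ha hz).of_norm hz'
  refine key.congr_deriv ?_
  have hs : Summable fun k : ℕ => a k * (k * z ^ (k - 1)) :=
    .of_norm_bounded hsum fun k => hbound k z hz'
  rw [hs.tsum_eq_zero_add]
  simp only [Nat.cast_zero, zero_mul, mul_zero, zero_add, Nat.add_sub_cancel]
  exact tsum_congr fun k => by ring

lemma bmpP_zero {K : Type*} [Field K] (α : K) : bmpP α 0 = 1 := by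
  rw [bmpP]

lemma bmpP_succ {K : Type*} [Field K] (α : K) (n : ℕ) :
    bmpP α (n + 1) =
      (α / (n + 1)) * ∑ k ∈ Finset.range (n + 1), ((k + 1 : K) / (k + 2)) * bmpP α (n - k) := by
  rw [bmpP]

lemma bmpP_mem_Icc {α : ℝ} (h0 : 0 ≤ α) (h1 : α ≤ 1) (n : ℕ) : bmpP α n ∈ Icc (0 : ℝ) 1 := by
  induction n using Nat.strong_induction_on with
  | _ n ih =>
    cases n with
    | zero => simp [bmpP_zero]
    | succ n =>
      have hfac : ∀ k : ℕ, 0 ≤ ((k + 1 : ℝ) / (k + 2)) ∧ ((k + 1 : ℝ) / (k + 2)) ≤ 1 := fun k =>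
        ⟨by positivity, (div_le_one (by positivity)).2 (by linarith)⟩
      have hmem : ∀ k, bmpP α (n - k) ∈ Icc (0 : ℝ) 1 := fun k => ih _ (by omega)
      rw [bmpP_succ]
      constructor
      · exact mul_nonneg (by positivity)
          (Finset.sum_nonneg fun k _ => mul_nonneg (hfac k).1 (hmem k).1)
      · have hsum : ∑ k ∈ Finset.range (n + 1), ((k + 1 : ℝ) / (k + 2)) * bmpP α (n - k)
            ≤ (n + 1 : ℝ) := by
          refine (Finset.sum_le_card_nsmul _ _ 1 fun k _ =>
            mul_le_one₀ (hfac k).2 (hmem k).1 (hmem k).2).trans ?_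
          simp
        calc _ ≤ α / (n + 1) * (n + 1 : ℝ) := by gcongr
          _ = α := by field_simp
          _ ≤ 1 := h1

lemma norm_bmpP_le_one {α : ℝ} (h0 : 0 ≤ α) (h1 : α ≤ 1) (n : ℕ) : ‖((bmpP α n : ℝ) : ℂ)‖ ≤ 1 := by
  have := bmpP_mem_Icc h0 h1 n
  rw [Complex.norm_real, Real.norm_of_nonneg this.1]
  exact this.2

/-- The generating function of `bmpP α`. -/
noncomputable def bmpGen (α : ℝ) (z : ℂ) : ℂ := ∑' k, ((bmpP α k : ℝ) : ℂ) * z ^ k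

lemma hasDerivAt_bmpGen {α : ℝ} (h0 : 0 ≤ α) (h1 : α ≤ 1) {z : ℂ} (hz : ‖z‖ < 1) :
    HasDerivAt (bmpGen α) (α * (∑' k : ℕ, ((k + 1 : ℂ) / (k + 2)) * z ^ k) * bmpGen α z) z := by
  have key := hasDerivAt_tsum_mul_pow (norm_bmpP_le_one h0 h1) hz
  have hA : ∀ k : ℕ, ‖((k + 1 : ℂ) / (k + 2))‖ ≤ 1 := by
    intro k
    have : ((k + 1 : ℂ) / (k + 2)) = (((k + 1 : ℝ) / (k + 2) : ℝ) : ℂ) := by push_cast; rfl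
    rw [this, Complex.norm_real, Real.norm_of_nonneg (by positivity)]
    exact (div_le_one (by positivity)).2 (by linarith)
  refine key.congr_deriv ?_
  rw [bmpGen, mul_assoc, tsum_mul_tsum_eq_tsum_sum_range_of_summable_norm
    (summable_norm_mul_pow_of_norm_le_one hA hz)
    (summable_norm_mul_pow_of_norm_le_one (norm_bmpP_le_one h0 h1) hz), ← tsum_mul_left]
  refine tsum_congr fun n => ?_
  rw [bmpP_succ]
  have hn : (n + 1 : ℂ) ≠ 0 := Nat.cast_add_one_ne_zero n
  have hsum : ∑ k ∈ Finset.range (n + 1),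
      ((k + 1 : ℂ) / (k + 2)) * z ^ k * (((bmpP α (n - k) : ℝ) : ℂ) * z ^ (n - k)) =
      (∑ k ∈ Finset.range (n + 1), ((k + 1 : ℂ) / (k + 2)) * ((bmpP α (n - k) : ℝ) : ℂ)) * z ^ n := by
    rw [Finset.sum_mul]
    refine Finset.sum_congr rfl fun k hk => ?_
    have : z ^ n = z ^ k * z ^ (n - k) := by
      rw [← pow_add]; congr 1; have := Finset.mem_range.1 hk; omega
    rw [this]; ring
  rw [hsum]
  push_cast
  field_simp

lemma bmpGen_eq {α : ℝ} (h0 : 0 ≤ α) (h1 : α ≤ 1) {z : ℂ} (hz : ‖z‖ < 1) (hz0 : z ≠ 0) :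
    bmpGen α z = Complex.exp (-α) * Complex.exp (α * (-Complex.log (1 - z) / z)) := by
  set E : ℂ → ℂ := fun z => ∑' k : ℕ, (1 / (k + 1 : ℂ)) * z ^ k with hE
  have ha : ∀ k : ℕ, ‖(1 / (k + 1 : ℂ))‖ ≤ 1 := by
    intro k
    have : (1 / (k + 1 : ℂ)) = ((1 / (k + 1 : ℝ) : ℝ) : ℂ) := by push_cast; rfl
    rw [this, Complex.norm_real, Real.norm_of_nonneg (by positivity)]
    exact (div_le_one (by positivity)).2 (by linarith [Nat.cast_nonneg (α := ℝ) k])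
  have hdE : ∀ z : ℂ, ‖z‖ < 1 →
      HasDerivAt E (∑' k : ℕ, ((k + 1 : ℂ) / (k + 2)) * z ^ k) z := by
    intro z hz
    refine (hasDerivAt_tsum_mul_pow ha hz).congr_deriv ?_
    refine tsum_congr fun k => ?_
    have : (k + 2 : ℂ) ≠ 0 := by exact_mod_cast (by omega : k + 2 ≠ 0)
    have : (k + 1 + 1 : ℂ) ≠ 0 := by exact_mod_cast (by omega : k + 1 + 1 ≠ 0)
    push_cast
    field_simp
    ring
  have hd : ∀ z ∈ Metric.ball (0 : ℂ) 1,
      HasDerivAt (fun z => bmpGen α z * Complex.exp (-(α * E z))) 0 z := by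
    intro z hz
    rw [mem_ball_zero_iff] at hz
    refine ((hasDerivAt_bmpGen h0 h1 hz).mul
      (((hdE z hz).const_mul (α : ℂ)).neg.cexp)).congr_deriv ?_
    ring
  have hconst := IsOpen.is_const_of_deriv_eq_zero Metric.isOpen_ball
    (convex_ball (0 : ℂ) 1).isPreconnected
    (fun z hz => (hd z hz).differentiableAt.differentiableWithinAt)
    (fun z hz => (hd z hz).deriv) (x := z) (y := 0) (by simpa using hz) (by simp)
  have hE0 : E 0 = 1 := by
    simp only [hE]
    rw [tsum_eq_single 0 (by intro k hk; simp [hk])]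
    simp
  have hP0 : bmpGen α 0 = 1 := by
    rw [bmpGen, tsum_eq_single 0 (by intro k hk; simp [hk])]
    simp [bmpP_zero]
  have hEz : E z = -Complex.log (1 - z) / z := by
    rw [eq_div_iff hz0, ← (Complex.hasSum_taylorSeries_neg_log hz).tsum_eq,
      (Complex.hasSum_taylorSeries_neg_log hz).summable.tsum_eq_zero_add]
    simp only [hE, ← tsum_mul_right]
    simp only [Nat.cast_zero, div_zero, zero_add]
    exact tsum_congr fun k => by push_cast; ring
  simp only [hE0, hP0, one_mul, mul_one, hEz] at hconst
  rw [← hconst, mul_assoc, ← Complex.exp_add]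
  simp

lemma integral_re_bmpGen_mul_exp {α : ℝ} (h0 : 0 ≤ α) (h1 : α ≤ 1) {S : ℝ} (hS : 0 < S) (n : ℕ) :
    ∫ θ in (0 : ℝ)..Real.pi, (bmpGen α (Complex.exp (-((S : ℂ) + θ * Complex.I))) *
      Complex.exp (n * ((S : ℂ) + θ * Complex.I))).re = Real.pi * bmpP α n := by
  have hsumm : Summable fun k : ℕ => Real.exp (n * S) * Real.exp (-S) ^ k :=
    (summable_geometric_of_lt_one (Real.exp_pos _).le
      (Real.exp_lt_one_iff.2 (by linarith))).mul_left _
  have hterm : ∀ (k : ℕ) (θ : ℝ),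
      (((bmpP α k : ℝ) : ℂ) * Complex.exp (-((S : ℂ) + θ * Complex.I)) ^ k *
        Complex.exp (n * ((S : ℂ) + θ * Complex.I))).re =
      bmpP α k * (Real.exp (((n : ℝ) - k) * S) * Real.cos (((n : ℝ) - k) * θ)) := by
    intro k θ
    rw [mul_assoc, ← Complex.exp_nat_mul, ← Complex.exp_add, Complex.re_ofReal_mul, Complex.exp_re]
    congr 3 <;> simp <;> ring
  have key := intervalIntegral.hasSum_integral_of_dominated_convergence
    (μ := volume) (a := 0) (b := Real.pi)
    (F := fun (k : ℕ) (θ : ℝ) =>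
      bmpP α k * (Real.exp (((n : ℝ) - k) * S) * Real.cos (((n : ℝ) - k) * θ)))
    (f := fun θ : ℝ => (bmpGen α (Complex.exp (-((S : ℂ) + θ * Complex.I))) *
      Complex.exp (n * ((S : ℂ) + θ * Complex.I))).re)
    (fun k _ => Real.exp (n * S) * Real.exp (-S) ^ k)
    (fun k => (by fun_prop : Continuous _).aestronglyMeasurable)
    (fun k => .of_forall fun θ _ => by
      have hk := bmpP_mem_Icc h0 h1 k
      have : Real.exp (n * S) * Real.exp (-S) ^ k = Real.exp (((n : ℝ) - k) * S) := by
        rw [← Real.exp_nat_mul, ← Real.exp_add]; ring_nf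
      rw [this, norm_mul, norm_mul, Real.norm_of_nonneg hk.1,
        Real.norm_of_nonneg (Real.exp_pos _).le]
      refine (mul_le_of_le_one_left (by positivity) hk.2).trans ?_
      exact mul_le_of_le_one_right (by positivity) (Real.abs_cos_le_one _))
    (.of_forall fun θ _ => hsumm) (by simp)
    (.of_forall fun θ _ => by
      have hz : ‖Complex.exp (-((S : ℂ) + θ * Complex.I))‖ < 1 := by
        rw [Complex.norm_exp]
        simpa using hS
      have hs := ((summable_norm_mul_pow_of_norm_le_one
        (norm_bmpP_le_one h0 h1) hz).of_norm.hasSum.mul_right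
          (Complex.exp (n * ((S : ℂ) + θ * Complex.I))))
      simpa only [hterm, bmpGen] using Complex.hasSum_re hs)
  refine key.unique ?_
  have hn := hasSum_single (f := fun k : ℕ => ∫ θ in (0 : ℝ)..Real.pi,
    bmpP α k * (Real.exp (((n : ℝ) - k) * S) * Real.cos (((n : ℝ) - k) * θ))) n (by
      intro k hk
      have hnk : ((n : ℝ) - k) ≠ 0 := sub_ne_zero.2 (by exact_mod_cast hk.symm)
      rw [intervalIntegral.integral_const_mul, intervalIntegral.integral_const_mul,
        intervalIntegral.integral_comp_mul_left _ hnk]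
      have : Real.sin (((n : ℝ) - k) * Real.pi) = 0 := by
        have := Real.sin_int_mul_pi ((n : ℤ) - k)
        push_cast at this
        exact this
      simp [this])
  simpa [mul_comm] using hn

lemma continuousWithinAt_log_of_ne_zero {z : ℂ} (hz0 : z ≠ 0) :
    ContinuousWithinAt Complex.log {z | 0 ≤ z.im} z := by
  by_cases h : z ∈ Complex.slitPlane
  · exact (continuousAt_clog h).continuousWithinAt
  · rw [Complex.mem_slitPlane_iff] at h
    push Not at h
    refine Complex.continuousWithinAt_log_of_re_neg_of_im_zero (lt_of_le_of_ne h.1 fun hre => ?_) h.2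
    exact hz0 (Complex.ext hre h.2)

lemma continuousAt_mul_log_zero : ContinuousAt (fun z : ℂ => z * Complex.log z) 0 := by
  rw [ContinuousAt, zero_mul, tendsto_zero_iff_norm_tendsto_zero]
  have hlim : Tendsto (fun z : ℂ => |‖z‖ * Real.log ‖z‖| + ‖z‖ * Real.pi) (nhds 0) (nhds 0) := by
    have : Continuous fun z : ℂ => |‖z‖ * Real.log ‖z‖| + ‖z‖ * Real.pi :=
      (Real.continuous_mul_log.comp continuous_norm).abs.add (by fun_prop)
    simpa using this.tendsto 0
  refine squeeze_zero (fun _ => norm_nonneg _) (fun z => ?_) hlim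
  rw [norm_mul, abs_mul, abs_norm, ← mul_add]
  gcongr
  refine (Complex.norm_le_abs_re_add_abs_im _).trans ?_
  rw [Complex.log_re, Complex.log_im]
  gcongr
  exact Complex.abs_arg_le_pi z

lemma continuousOn_mul_log_of_im_nonneg :
    ContinuousOn (fun z : ℂ => z * Complex.log z) {z | 0 ≤ z.im} := by
  intro z _
  rcases eq_or_ne z 0 with rfl | hz0
  · exact continuousAt_mul_log_zero.continuousWithinAt
  · exact continuousWithinAt_id.mul (continuousWithinAt_log_of_ne_zero hz0)

lemma continuousOn_cpow_const_of_im_nonneg {c : ℝ} (hc : 0 ≤ c) :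
    ContinuousOn (fun z : ℂ => z ^ (c : ℂ)) {z | 0 ≤ z.im} := by
  rcases hc.eq_or_lt with rfl | hc
  · simpa using continuousOn_const
  intro z _
  rcases eq_or_ne z 0 with rfl | hz0
  · exact (Complex.continuousAt_cpow_const_of_re_pos (by simp) (by simpa)).continuousWithinAt
  · have h : ContinuousWithinAt (fun z : ℂ => Complex.exp (Complex.log z * c)) {z | 0 ≤ z.im} z :=
      ((continuousWithinAt_log_of_ne_zero hz0).mul continuousWithinAt_const).cexp
    refine h.congr_of_eventuallyEq ?_ (Complex.cpow_def_of_ne_zero hz0 _)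
    filter_upwards [mem_nhdsWithin_of_mem_nhds (isOpen_ne.mem_nhds hz0)] with w hw
    exact Complex.cpow_def_of_ne_zero hw _

/-- The function `u ↦ u · u ^ (-α (u + 1))`, extended by continuity to the closed upper half
plane. -/
noncomputable def bmpBranch (α : ℝ) (u : ℂ) : ℂ :=
  u ^ ((1 - α : ℝ) : ℂ) * Complex.exp (-α * (u * Complex.log u))

lemma bmpBranch_eq (α : ℝ) {u : ℂ} (hu : u ≠ 0) :
    bmpBranch α u = u * Complex.exp (-α * (u + 1) * Complex.log u) := by
  have : u = Complex.exp (Complex.log u) := (Complex.exp_log hu).symm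
  rw [bmpBranch, Complex.cpow_def_of_ne_zero hu]
  nth_rw 4 [this]
  rw [← Complex.exp_add, ← Complex.exp_add]
  congr 1
  push_cast
  ring

lemma continuousOn_bmpBranch {α : ℝ} (h1 : α ≤ 1) :
    ContinuousOn (bmpBranch α) {z | 0 ≤ z.im} :=
  (continuousOn_cpow_const_of_im_nonneg (by linarith)).mul
    (continuousOn_const.mul continuousOn_mul_log_of_im_nonneg).cexp

/-- The function `(w - 1) w ^ n (w / (w - 1)) ^ (α w)` in the logarithmic coordinate
`w = exp ζ`. -/
noncomputable def bmpKernel (α : ℝ) (n : ℕ) (ζ : ℂ) : ℂ :=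
  Complex.exp (n * ζ) * Complex.exp (α * (Complex.exp ζ * ζ)) * bmpBranch α (Complex.exp ζ - 1)

lemma exp_sub_one_im_nonneg {ζ : ℂ} (h0 : 0 ≤ ζ.im) (hpi : ζ.im ≤ Real.pi) :
    0 ≤ (Complex.exp ζ - 1).im := by
  rw [Complex.sub_im, Complex.exp_im, Complex.one_im, sub_zero]
  exact mul_nonneg (Real.exp_pos _).le (Real.sin_nonneg_of_nonneg_of_le_pi h0 hpi)

lemma continuousOn_bmpKernel {α : ℝ} (h1 : α ≤ 1) (n : ℕ) :
    ContinuousOn (bmpKernel α n) {ζ | 0 ≤ ζ.im ∧ ζ.im ≤ Real.pi} := by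
  refine ContinuousOn.mul (by fun_prop) ?_
  exact (continuousOn_bmpBranch h1).comp (by fun_prop) fun ζ hζ => exp_sub_one_im_nonneg hζ.1 hζ.2

lemma bmpKernel_eq (α : ℝ) (n : ℕ) {ζ : ℂ} (h : Complex.exp ζ - 1 ≠ 0) :
    bmpKernel α n ζ = Complex.exp (n * ζ) * (Complex.exp ζ - 1) *
      Complex.exp (α * (Complex.exp ζ * (ζ - Complex.log (Complex.exp ζ - 1)))) := by
  rw [bmpKernel, bmpBranch_eq α h]
  have : Complex.exp (α * (Complex.exp ζ * (ζ - Complex.log (Complex.exp ζ - 1)))) =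
      Complex.exp (α * (Complex.exp ζ * ζ)) *
        Complex.exp (-α * (Complex.exp ζ - 1 + 1) * Complex.log (Complex.exp ζ - 1)) := by
    rw [← Complex.exp_add]
    congr 1
    ring
  rw [this]
  ring

lemma differentiableAt_bmpKernel (α : ℝ) (n : ℕ) {ζ : ℂ} (h0 : 0 < ζ.im) (hpi : ζ.im < Real.pi) :
    DifferentiableAt ℂ (bmpKernel α n) ζ := by
  have him : (Complex.exp ζ - 1).im ≠ 0 := by
    rw [Complex.sub_im, Complex.exp_im, Complex.one_im, sub_zero]
    exact (mul_pos (Real.exp_pos _) (Real.sin_pos_of_pos_of_lt_pi h0 hpi)).ne'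
  have hslit : Complex.exp ζ - 1 ∈ Complex.slitPlane := Complex.mem_slitPlane_iff.2 (.inr him)
  unfold bmpKernel bmpBranch
  have hd : DifferentiableAt ℂ (fun ζ : ℂ => Complex.exp ζ - 1) ζ := by fun_prop
  refine DifferentiableAt.mul (by fun_prop) ?_
  exact (hd.cpow_const hslit).mul (((hd.mul (hd.clog hslit)).const_mul _).cexp)

lemma exists_norm_bmpKernel_le {α : ℝ} (h0 : 0 ≤ α) (h1 : α ≤ 1) (n : ℕ) :
    ∃ C : ℝ, ∀ s θ : ℝ, s ≤ 0 → 0 ≤ θ → θ ≤ Real.pi →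
      ‖bmpKernel α n (s + θ * Complex.I)‖ ≤ Real.exp (n * s) * C := by
  have hcomp : IsCompact (Metric.closedBall (0 : ℂ) 2 ∩ {z | 0 ≤ z.im}) :=
    (isCompact_closedBall 0 2).inter_right (isClosed_le continuous_const Complex.continuous_im)
  obtain ⟨C, hC⟩ := hcomp.exists_bound_of_continuousOn
    ((continuousOn_bmpBranch h1).mono inter_subset_right)
  refine ⟨Real.exp (1 + Real.pi) * C, fun s θ hs hθ hθ' => ?_⟩
  set ζ : ℂ := s + θ * Complex.I with hζ
  have hre : ζ.re = s := by simp [hζ]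
  have him : ζ.im = θ := by simp [hζ]
  have hexp : ‖Complex.exp ζ‖ = Real.exp s := by rw [Complex.norm_exp, hre]
  have hexp1 : Real.exp s ≤ 1 := Real.exp_le_one_iff.2 hs
  have hb : ‖bmpBranch α (Complex.exp ζ - 1)‖ ≤ C := by
    refine hC _ ⟨?_, exp_sub_one_im_nonneg (him ▸ hθ) (him ▸ hθ')⟩
    rw [mem_closedBall_zero_iff]
    refine (norm_sub_le _ _).trans ?_
    rw [hexp, norm_one]
    linarith
  have hmid : ‖Complex.exp (α * (Complex.exp ζ * ζ))‖ ≤ Real.exp (1 + Real.pi) := by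
    refine (Complex.norm_exp_le_exp_norm _).trans (Real.exp_le_exp.2 ?_)
    rw [norm_mul, norm_mul, hexp, Complex.norm_real, Real.norm_of_nonneg h0]
    refine (mul_le_of_le_one_left (by positivity) h1).trans ?_
    have hn : ‖ζ‖ ≤ |s| + Real.pi := by
      refine (Complex.norm_le_abs_re_add_abs_im _).trans ?_
      rw [hre, him, abs_of_nonneg hθ]
      gcongr
    have hs1 : Real.exp s * |s| ≤ 1 := by
      have := Real.abs_log_mul_self_lt (Real.exp s) (Real.exp_pos s) hexp1
      rw [Real.log_exp, abs_mul, Real.abs_exp] at this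
      linarith
    calc Real.exp s * ‖ζ‖ ≤ Real.exp s * (|s| + Real.pi) := by gcongr
      _ = Real.exp s * |s| + Real.exp s * Real.pi := by ring
      _ ≤ 1 + 1 * Real.pi := by gcongr
      _ = 1 + Real.pi := by ring
  have hfst : ‖Complex.exp (n * ζ)‖ = Real.exp (n * s) := by
    rw [Complex.norm_exp]
    simp [hre]
  rw [bmpKernel, norm_mul, norm_mul, hfst, mul_assoc]
  gcongr

lemma bmpKernel_eq_bmpGen {α : ℝ} (h0 : 0 ≤ α) (h1 : α ≤ 1) (n : ℕ) {ζ : ℂ} (hre : 0 < ζ.re)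
    (him : 0 ≤ ζ.im) (hpi : ζ.im ≤ Real.pi) :
    bmpKernel α n ζ = Real.exp α * (bmpGen α (Complex.exp (-ζ)) * Complex.exp ((n + 1 : ℕ) * ζ) -
      bmpGen α (Complex.exp (-ζ)) * Complex.exp (n * ζ)) := by
  set u : ℂ := Complex.exp ζ - 1 with hu
  have hnorm : 1 < ‖Complex.exp ζ‖ := by
    rw [Complex.norm_exp]
    exact Real.one_lt_exp_iff.2 hre
  have hu0 : u ≠ 0 := by
    intro h
    have h' : Complex.exp ζ = 1 := sub_eq_zero.1 h
    rw [h', norm_one] at hnorm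
    exact lt_irrefl _ hnorm
  have huim : 0 ≤ u.im := exp_sub_one_im_nonneg him hpi
  have harg : -Real.pi < u.arg - ζ.im := by
    have hnn : 0 ≤ u.arg := Complex.arg_nonneg_iff.2 huim
    rcases hpi.lt_or_eq with h | h
    · linarith
    · have : u.arg = Real.pi := by
        rw [Complex.arg_eq_pi_iff]
        simp only [hu, Complex.sub_re, Complex.exp_re, Complex.sub_im, Complex.exp_im, h]
        simp only [Real.cos_pi, Real.sin_pi, Complex.one_re, Complex.one_im]
        constructor
        · linarith [Real.exp_pos ζ.re]
        · ring
      linarith [Real.pi_pos]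
  have hlog : Complex.log (1 - Complex.exp (-ζ)) = Complex.log u - ζ := by
    have : 1 - Complex.exp (-ζ) = Complex.exp (Complex.log u - ζ) := by
      rw [Complex.exp_sub, Complex.exp_log hu0, hu, Complex.exp_neg, sub_div,
        div_self (Complex.exp_ne_zero ζ), one_div]
    rw [this, Complex.log_exp]
    · rwa [Complex.sub_im, Complex.log_im]
    · rw [Complex.sub_im, Complex.log_im]
      linarith [Complex.arg_le_pi u]
  have hz : ‖Complex.exp (-ζ)‖ < 1 := by
    rw [Complex.norm_exp]
    simpa using hre
  rw [bmpKernel_eq α n hu0, bmpGen_eq h0 h1 hz (Complex.exp_ne_zero _), hlog]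
  have hexp : Complex.exp ((n + 1 : ℕ) * ζ) = Complex.exp (n * ζ) * Complex.exp ζ := by
    rw [← Complex.exp_add]; push_cast; ring_nf
  have hα : (Real.exp α : ℂ) * Complex.exp (-α) = 1 := by
    rw [Complex.ofReal_exp, ← Complex.exp_add]; simp
  have hdiv : -(Complex.log u - ζ) / Complex.exp (-ζ) =
      Complex.exp ζ * (ζ - Complex.log u) := by
    rw [Complex.exp_neg]; field_simp; ring
  rw [hexp, hdiv]
  linear_combination (-(Complex.exp (n * ζ) * (Complex.exp ζ - 1) *
    Complex.exp (α * (Complex.exp ζ * (ζ - Complex.log u))))) * hα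

lemma bmpKernel_im_of_pos (α : ℝ) (n : ℕ) {s : ℝ} (hs : 0 < s) : (bmpKernel α n s).im = 0 := by
  have hpos : 0 < Real.exp s - 1 := by linarith [Real.one_lt_exp_iff.2 hs]
  have hu : Complex.exp s - 1 = ((Real.exp s - 1 : ℝ) : ℂ) := by push_cast; rfl
  rw [bmpKernel_eq α n (by rw [hu]; exact_mod_cast hpos.ne'), hu, ← Complex.ofReal_log hpos.le]
  exact_mod_cast Complex.ofReal_im (Real.exp (n * s) * (Real.exp s - 1) *
    Real.exp (α * (Real.exp s * (s - Real.log (Real.exp s - 1)))))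

lemma log_ofReal_of_neg {x : ℝ} (hx : x < 0) :
    Complex.log x = Real.log (-x) + Real.pi * Complex.I := by
  rw [Complex.log, Complex.arg_ofReal_of_neg hx, Complex.norm_real, Real.norm_of_nonpos hx.le]

lemma bmpKernel_im_add_pi (α : ℝ) (n : ℕ) (s : ℝ) :
    (bmpKernel α n (s + Real.pi * Complex.I)).im = 0 := by
  have hneg : -Real.exp s - 1 < 0 := by linarith [Real.exp_pos s]
  have hexp : Complex.exp (s + Real.pi * Complex.I) = -Real.exp s := by
    rw [Complex.exp_add, Complex.exp_pi_mul_I]; simp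
  have hu : Complex.exp (s + Real.pi * Complex.I) - 1 = ((-Real.exp s - 1 : ℝ) : ℂ) := by
    rw [hexp]; push_cast; rfl
  have hn : Complex.exp (n * (s + Real.pi * Complex.I)) = (((-Real.exp s) ^ n : ℝ) : ℂ) := by
    rw [Complex.exp_nat_mul, hexp]; push_cast; rfl
  rw [bmpKernel_eq α n (by rw [hu]; exact_mod_cast hneg.ne), hu, hn, hexp, log_ofReal_of_neg hneg,
    add_sub_add_right_eq_sub]
  exact_mod_cast Complex.ofReal_im ((-Real.exp s) ^ n * (-Real.exp s - 1) *
    Real.exp (α * (-Real.exp s * (s - Real.log (-(-Real.exp s - 1))))))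

lemma bmpKernel_im_log (α : ℝ) (n : ℕ) {x : ℝ} (hx : x ∈ Ioo (0 : ℝ) 1) :
    (bmpKernel α n (Real.log x)).im =
      (x / (1 - x)) ^ (α * x) * Real.sin (α * Real.pi * x) * ((1 - x) * x ^ n) := by
  have hneg : x - 1 < 0 := by linarith [hx.2]
  have hexp : Complex.exp (Real.log x) = x := by
    rw [← Complex.ofReal_exp, Real.exp_log hx.1]
  have hu : Complex.exp (Real.log x) - 1 = ((x - 1 : ℝ) : ℂ) := by rw [hexp]; push_cast; rfl
  rw [bmpKernel_eq α n (by rw [hu]; exact_mod_cast hneg.ne), hu, Complex.exp_nat_mul, hexp,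
    log_ofReal_of_neg hneg, neg_sub]
  have harg : (α : ℂ) * (x * (Real.log x - (Real.log (1 - x) + Real.pi * Complex.I))) =
      ((α * x * (Real.log x - Real.log (1 - x)) : ℝ) : ℂ) +
        ((-(α * Real.pi * x) : ℝ) : ℂ) * Complex.I := by
    push_cast; ring
  have hpow : (x / (1 - x)) ^ (α * x) = Real.exp (α * x * (Real.log x - Real.log (1 - x))) := by
    rw [Real.rpow_def_of_pos (div_pos hx.1 (by linarith)),
      Real.log_div hx.1.ne' (by linarith)]
    ring_nf
  have hfac : (x : ℂ) ^ n * ((x - 1 : ℝ) : ℂ) = ((x ^ n * (x - 1) : ℝ) : ℂ) := by push_cast; rfl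
  rw [harg, hfac, Complex.im_ofReal_mul, Complex.exp_im, hpow]
  simp only [Complex.add_re, Complex.add_im, Complex.ofReal_re, Complex.ofReal_im,
    Complex.re_ofReal_mul, Complex.im_ofReal_mul, Complex.I_re, Complex.I_im, mul_zero, mul_one,
    add_zero, zero_add, Real.sin_neg]
  ring

lemma integral_re_bmpKernel {α : ℝ} (h0 : 0 ≤ α) (h1 : α ≤ 1) (n : ℕ) {S : ℝ} (hS : 0 < S) :
    ∫ θ in (0 : ℝ)..Real.pi, (bmpKernel α n (S + θ * Complex.I)).re =
      Real.exp α * Real.pi * (bmpP α (n + 1) - bmpP α n) := by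
  have hcont : ∀ m : ℕ, ContinuousOn (fun θ : ℝ =>
      (bmpGen α (Complex.exp (-((S : ℂ) + θ * Complex.I))) *
      Complex.exp (m * ((S : ℂ) + θ * Complex.I))).re) (uIcc 0 Real.pi) := by
    intro m θ _
    have hz : ‖Complex.exp (-((S : ℂ) + θ * Complex.I))‖ < 1 := by
      rw [Complex.norm_exp]
      simpa using hS
    have h : ContinuousAt (fun θ : ℝ => bmpGen α (Complex.exp (-((S : ℂ) + θ * Complex.I)))) θ :=
      ContinuousAt.comp (f := fun θ : ℝ => Complex.exp (-((S : ℂ) + θ * Complex.I)))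
        (hasDerivAt_bmpGen h0 h1 hz).continuousAt (by fun_prop)
    exact (Complex.continuous_re.continuousAt.comp (h.mul (by fun_prop))).continuousWithinAt
  have hcongr : ∀ θ ∈ uIcc 0 Real.pi, (bmpKernel α n (S + θ * Complex.I)).re = Real.exp α *
      ((bmpGen α (Complex.exp (-((S : ℂ) + θ * Complex.I))) *
        Complex.exp ((n + 1 : ℕ) * ((S : ℂ) + θ * Complex.I))).re -
      (bmpGen α (Complex.exp (-((S : ℂ) + θ * Complex.I))) *
        Complex.exp (n * ((S : ℂ) + θ * Complex.I))).re) := by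
    intro θ hθ
    rw [uIcc_of_le Real.pi_pos.le] at hθ
    rw [bmpKernel_eq_bmpGen h0 h1 n (by simpa using hS) (by simpa using hθ.1)
      (by simpa using hθ.2), Complex.re_ofReal_mul, Complex.sub_re]
  rw [intervalIntegral.integral_congr hcongr, intervalIntegral.integral_const_mul,
    intervalIntegral.integral_sub (hcont _).intervalIntegrable (hcont _).intervalIntegrable,
    integral_re_bmpGen_mul_exp h0 h1 hS, integral_re_bmpGen_mul_exp h0 h1 hS]
  ring

lemma integral_im_bmpKernel {α : ℝ} (h0 : 0 ≤ α) (h1 : α ≤ 1) (n : ℕ) (s : ℝ) :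
    ∫ t in s..0, (bmpKernel α n t).im = Real.exp α * Real.pi * (bmpP α n - bmpP α (n + 1)) +
      ∫ θ in (0 : ℝ)..Real.pi, (bmpKernel α n (s + θ * Complex.I)).re := by
  have hpi := Real.pi_pos
  have hK := continuousOn_bmpKernel h1 n
  have hrect := Complex.integral_boundary_rect_eq_zero_of_continuousOn_of_differentiableOn
    (bmpKernel α n) s (1 + Real.pi * Complex.I)
    (hK.mono fun ζ hζ => by
      have := hζ.2
      simpa [uIcc_of_le hpi.le] using this)
    (fun ζ hζ => by
      have := hζ.2
      simp [hpi.le] at this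
      exact (differentiableAt_bmpKernel α n this.1 this.2).differentiableWithinAt)
  simp only [Complex.ofReal_re, Complex.ofReal_im, Complex.add_re, Complex.add_im, Complex.one_re,
    Complex.one_im, Complex.re_ofReal_mul, Complex.im_ofReal_mul, Complex.I_re, Complex.I_im,
    mul_zero, mul_one, add_zero, zero_add, Complex.ofReal_zero, zero_mul, smul_eq_mul] at hrect
  have hbot : ∀ a b : ℝ, IntervalIntegrable (fun t : ℝ => bmpKernel α n t) volume a b := fun a b =>
    (hK.comp_continuous (by fun_prop) fun t => by simpa using hpi.le).intervalIntegrable a b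
  have htop : IntervalIntegrable (fun t : ℝ => bmpKernel α n (t + Real.pi * Complex.I))
      volume s 1 :=
    (hK.comp_continuous (by fun_prop) fun t => by simpa using hpi.le).intervalIntegrable _ _
  have hside : ∀ r : ℝ, IntervalIntegrable (fun θ : ℝ => bmpKernel α n (r + θ * Complex.I))
      volume 0 Real.pi := fun r =>
    (hK.comp (f := fun θ : ℝ => (r + θ * Complex.I : ℂ)) (by fun_prop) fun θ hθ => by
      simpa [uIcc_of_le hpi.le] using hθ).intervalIntegrable
  have him := congrArg Complex.im hrect
  simp only [Complex.sub_im, Complex.add_im, Complex.I_mul_im, Complex.zero_im] at him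
  have e1 := Complex.imCLM.intervalIntegral_comp_comm (hbot s 1)
  have e2 := Complex.imCLM.intervalIntegral_comp_comm htop
  have e3 := Complex.reCLM.intervalIntegral_comp_comm (hside 1)
  have e4 := Complex.reCLM.intervalIntegral_comp_comm (hside s)
  simp only [Complex.imCLM_apply, Complex.reCLM_apply] at e1 e2 e3 e4
  have e3' := integral_re_bmpKernel h0 h1 n one_pos
  rw [← e1, ← e2, ← e3, ← e4, e3'] at him
  simp only [bmpKernel_im_add_pi, intervalIntegral.integral_zero] at him
  have hbotim : ∀ a b : ℝ, IntervalIntegrable (fun t : ℝ => (bmpKernel α n t).im) volume a b :=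
    fun a b => (Complex.continuous_im.comp
      (hK.comp_continuous (by fun_prop) fun t => by simpa using hpi.le)).intervalIntegrable a b
  have hzero : ∫ t in (0 : ℝ)..1, (bmpKernel α n t).im = 0 := by
    refine intervalIntegral.integral_zero_ae (.of_forall fun t ht => ?_)
    rw [uIoc_of_le zero_le_one] at ht
    exact bmpKernel_im_of_pos α n ht.1
  rw [← intervalIntegral.integral_add_adjacent_intervals (hbotim s 0) (hbotim 0 1), hzero] at him
  linarith

/-- The (unnormalized) density of the representing measure. -/
noncomputable def bmpDensity (α x : ℝ) : ℝ :=
  (x / (1 - x)) ^ (α * x) * Real.sin (α * Real.pi * x)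

lemma measurable_bmpDensity (α : ℝ) : Measurable (bmpDensity α) := by
  unfold bmpDensity
  fun_prop

lemma bmpDensity_nonneg {α : ℝ} (h0 : 0 ≤ α) (h1 : α ≤ 1) {x : ℝ} (hx : x ∈ Ioo (0 : ℝ) 1) :
    0 ≤ bmpDensity α x := by
  have hx' : 0 < 1 - x := by linarith [hx.2]
  have hx0 := hx.1
  refine mul_nonneg (by positivity) (Real.sin_nonneg_of_nonneg_of_le_pi (by positivity) ?_)
  calc α * Real.pi * x ≤ 1 * Real.pi * 1 := by gcongr; exact hx.2.le
    _ = Real.pi := by ring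

lemma bmpDensity_mul_le_one {α : ℝ} (h0 : 0 ≤ α) (h1 : α ≤ 1) {x : ℝ} (hx : x ∈ Ioo (0 : ℝ) 1)
    (n : ℕ) : bmpDensity α x * ((1 - x) * x ^ n) ≤ 1 := by
  have hx' : 0 < 1 - x := by linarith [hx.2]
  have hx0 := hx.1
  have hαx : α * x ≤ 1 := mul_le_one₀ h1 hx0.le hx.2.le
  have hpow : (x / (1 - x)) ^ (α * x) * (1 - x) ≤ 1 := by
    rw [Real.div_rpow hx0.le hx'.le, div_mul_eq_mul_div, div_le_one (by positivity)]
    calc x ^ (α * x) * (1 - x) ≤ 1 * (1 - x) ^ (α * x) := by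
          gcongr
          · exact Real.rpow_le_one hx0.le hx.2.le (by positivity)
          · simpa using Real.rpow_le_rpow_of_exponent_ge hx' (by linarith) hαx
      _ = (1 - x) ^ (α * x) := one_mul _
  have hxn : x ^ n ≤ 1 := pow_le_one₀ hx0.le hx.2.le
  have hnn := bmpDensity_nonneg h0 h1 hx
  calc bmpDensity α x * ((1 - x) * x ^ n) ≤ bmpDensity α x * ((1 - x) * 1) := by gcongr
    _ = (x / (1 - x)) ^ (α * x) * (1 - x) * Real.sin (α * Real.pi * x) := by
        rw [bmpDensity]; ring
    _ ≤ (x / (1 - x)) ^ (α * x) * (1 - x) * 1 := by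
        gcongr
        exact Real.sin_le_one _
    _ ≤ 1 := by simpa using hpow

lemma integrableOn_bmpDensity_mul {α : ℝ} (h0 : 0 ≤ α) (h1 : α ≤ 1) (n : ℕ) :
    IntegrableOn (fun x => bmpDensity α x * ((1 - x) * x ^ n)) (Ioo (0 : ℝ) 1) := by
  refine Measure.integrableOn_of_bounded (M := 1) (by simp)
    ((measurable_bmpDensity α).mul (by fun_prop)).aestronglyMeasurable ?_
  filter_upwards [ae_restrict_mem measurableSet_Ioo] with x hx
  have hx' : 0 < 1 - x := by linarith [hx.2]
  have hx0 := hx.1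
  rw [Real.norm_of_nonneg (mul_nonneg (bmpDensity_nonneg h0 h1 hx) (by positivity))]
  exact bmpDensity_mul_le_one h0 h1 hx n

lemma integral_bmpDensity_mul_eq {α : ℝ} (h1 : α ≤ 1) (n : ℕ) {t : ℝ}
    (ht : t ∈ Ioo (0 : ℝ) 1) :
    ∫ x in t..1, bmpDensity α x * ((1 - x) * x ^ n) =
      ∫ s in Real.log t..0, (bmpKernel α (n + 1) s).im := by
  set g : ℝ → ℝ := fun x => (bmpKernel α (n + 1) (Real.log x)).im / x with hg
  have hgc : ContinuousOn g (Ioi 0) := by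
    refine ContinuousOn.div (Complex.continuous_im.comp_continuousOn
      ((continuousOn_bmpKernel h1 (n + 1)).comp (f := fun x : ℝ => (Real.log x : ℂ)) ?_
        fun x _ => by simpa using Real.pi_pos.le)) continuousOn_id fun x hx => hx.ne'
    exact Complex.continuous_ofReal.comp_continuousOn
      (Real.continuousOn_log.mono fun x hx => (mem_Ioi.1 hx).ne')
  have hsub := intervalIntegral.integral_comp_mul_deriv' (a := Real.log t) (b := 0)
    (f := Real.exp) (f' := Real.exp) (g := g) (fun x _ => Real.hasDerivAt_exp x)
    Real.continuous_exp.continuousOn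
    (hgc.mono (by rintro _ ⟨y, _, rfl⟩; exact Real.exp_pos y))
  rw [Real.exp_log ht.1, Real.exp_zero] at hsub
  have hl : ∀ s : ℝ, (g ∘ Real.exp) s * Real.exp s = (bmpKernel α (n + 1) s).im := by
    intro s
    simp [hg]
  simp only [hl] at hsub
  rw [hsub, intervalIntegral.integral_of_le ht.2.le, intervalIntegral.integral_of_le ht.2.le,
    integral_Ioc_eq_integral_Ioo, integral_Ioc_eq_integral_Ioo]
  refine setIntegral_congr_fun measurableSet_Ioo fun x hx => ?_
  have hx0 : 0 < x := ht.1.trans hx.1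
  simp only [hg]
  rw [bmpKernel_im_log α (n + 1) ⟨hx0, hx.2⟩, bmpDensity]
  field_simp
  ring

/-- The consecutive differences of `bmpP α` are moments. -/
lemma bmpP_sub_eq_integral {α : ℝ} (h0 : 0 ≤ α) (h1 : α ≤ 1) (n : ℕ) :
    bmpP α (n + 1) - bmpP α (n + 2) = Real.exp (-α) / Real.pi *
      ∫ x in Ioo (0 : ℝ) 1, bmpDensity α x * ((1 - x) * x ^ n) := by
  set φ : ℝ → ℝ := fun x => bmpDensity α x * ((1 - x) * x ^ n)
  set D := Real.exp α * Real.pi * (bmpP α (n + 1) - bmpP α (n + 2))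
  obtain ⟨C, hC⟩ := exists_norm_bmpKernel_le h0 h1 (n + 1)
  have hC0 : 0 ≤ C := by
    have := (norm_nonneg _).trans (hC 0 0 le_rfl le_rfl Real.pi_pos.le)
    simpa using this
  have hbound : ∀ t ∈ Ioo (0 : ℝ) 1, ‖(∫ x in t..1, φ x) - D‖ ≤ t * C * Real.pi := by
    intro t ht
    have hlog : Real.log t < 0 := Real.log_neg ht.1 ht.2
    rw [integral_bmpDensity_mul_eq h1 n ht, integral_im_bmpKernel h0 h1 (n + 1),
      add_sub_cancel_left]
    have := intervalIntegral.norm_integral_le_of_norm_le_const (a := 0) (b := Real.pi)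
      (C := t * C) (f := fun θ : ℝ => (bmpKernel α (n + 1) (Real.log t + θ * Complex.I)).re)
      fun θ hθ => by
        rw [uIoc_of_le Real.pi_pos.le] at hθ
        refine (Complex.abs_re_le_norm _).trans ((hC _ θ hlog.le hθ.1.le hθ.2).trans ?_)
        gcongr
        rw [Real.exp_nat_mul, Real.exp_log ht.1]
        exact pow_le_of_le_one ht.1.le ht.2.le (by omega)
    simpa [abs_of_pos Real.pi_pos] using this
  have hinteg : IntegrableOn φ (uIcc 0 1) := by
    rw [uIcc_of_le zero_le_one, integrableOn_Icc_iff_integrableOn_Ioo]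
    exact integrableOn_bmpDensity_mul h0 h1 n
  have hlim : Tendsto (fun t => ∫ x in t..1, φ x) (nhdsWithin 0 (Ioo 0 1))
      (nhds (∫ x in (0 : ℝ)..1, φ x)) := by
    have := intervalIntegral.continuousOn_primitive_interval_left hinteg 0 (by simp)
    rw [uIcc_of_le zero_le_one] at this
    exact this.tendsto.mono_left (nhdsWithin_mono _ Ioo_subset_Icc_self)
  have hlim' : Tendsto (fun t => ∫ x in t..1, φ x) (nhdsWithin 0 (Ioo 0 1)) (nhds D) := by
    rw [tendsto_iff_norm_sub_tendsto_zero]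
    have h0 : Tendsto (fun t : ℝ => t * C * Real.pi) (nhdsWithin 0 (Ioo 0 1)) (nhds 0) := by
      have : Continuous fun t : ℝ => t * C * Real.pi := by fun_prop
      simpa using (this.tendsto 0).mono_left nhdsWithin_le_nhds
    refine squeeze_zero' (.of_forall fun _ => norm_nonneg _) ?_ h0
    filter_upwards [self_mem_nhdsWithin] with t ht using hbound t ht
  have hne : (nhdsWithin (0 : ℝ) (Ioo 0 1)).NeBot := left_nhdsWithin_Ioo_neBot one_pos
  have heq := tendsto_nhds_unique hlim hlim'
  rw [intervalIntegral.integral_of_le zero_le_one, integral_Ioc_eq_integral_Ioo] at heq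
  rw [heq, Real.exp_neg]
  have := Real.pi_pos
  simp only [D]
  field_simp

lemma bmpP_succ_succ_le {α : ℝ} (h0 : 0 ≤ α) (h1 : α ≤ 1) (n : ℕ) :
    bmpP α (n + 2) ≤ bmpP α (n + 1) := by
  rw [← sub_nonneg, bmpP_sub_eq_integral h0 h1]
  refine mul_nonneg (by positivity) (setIntegral_nonneg measurableSet_Ioo fun x hx => ?_)
  have hx' : 0 < 1 - x := by linarith [hx.2]
  have hx0 := hx.1
  exact mul_nonneg (bmpDensity_nonneg h0 h1 hx) (by positivity)

lemma one_sub_mul_tsum_bmpP {α : ℝ} (h0 : 0 ≤ α) (h1 : α ≤ 1) {x : ℝ} (hx : x ∈ Ioo (0 : ℝ) 1) :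
    (1 - x) * ∑' k, bmpP α k * x ^ k =
      Real.exp (-α) * Real.exp ((x - α) / x * Real.log (1 - x)) := by
  have hx' : 0 < 1 - x := by linarith [hx.2]
  have hgen := bmpGen_eq h0 h1 (z := (x : ℂ))
    (by rw [Complex.norm_real, Real.norm_of_nonneg hx.1.le]; exact hx.2)
    (by exact_mod_cast hx.1.ne')
  have hlog : Complex.log (1 - x) = (Real.log (1 - x) : ℝ) := by
    rw [Complex.ofReal_log hx'.le]; push_cast; rfl
  rw [hlog, bmpGen] at hgen
  have hreal : ∑' k, bmpP α k * x ^ k = Real.exp (-α) * Real.exp (α * (-Real.log (1 - x) / x)) := by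
    exact_mod_cast hgen
  rw [hreal]
  nth_rw 1 [← Real.exp_log hx']
  rw [← Real.exp_add, ← Real.exp_add, ← Real.exp_add]
  congr 1
  have := hx.1
  field_simp
  ring

lemma tendsto_exp_mul_log_one_sub {α : ℝ} (h1 : α ≤ 1) :
    Tendsto (fun x : ℝ => Real.exp ((x - α) / x * Real.log (1 - x))) (nhdsWithin 1 (Iio 1))
      (nhds (if α = 1 then 1 else 0)) := by
  have hsub : Tendsto (fun x : ℝ => 1 - x) (nhdsWithin 1 (Iio 1)) (nhdsWithin 0 (Ioi 0)) := by
    refine tendsto_nhdsWithin_iff.2 ⟨?_, ?_⟩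
    · have : Continuous fun x : ℝ => 1 - x := by fun_prop
      simpa using (this.tendsto 1).mono_left nhdsWithin_le_nhds
    · filter_upwards [self_mem_nhdsWithin] with x hx
      simpa using hx
  have hid : Tendsto (fun x : ℝ => x) (nhdsWithin 1 (Iio 1)) (nhds 1) :=
    tendsto_id.mono_left nhdsWithin_le_nhds
  split_ifs with h
  · subst h
    have hm : Tendsto (fun x : ℝ => (1 - x) * Real.log (1 - x)) (nhdsWithin 1 (Iio 1)) (nhds 0) := by
      have := (Real.continuous_mul_log.tendsto 0).comp (hsub.mono_right nhdsWithin_le_nhds)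
      simpa [Function.comp_def] using this
    have := ((hm.neg.div hid one_ne_zero).rexp)
    simp only [neg_zero, zero_div, Real.exp_zero] at this
    refine this.congr fun x => ?_
    congr 1
    simp only [Pi.div_apply]
    ring
  · refine Real.tendsto_exp_atBot.comp ?_
    have hc : Tendsto (fun x : ℝ => (x - α) / x) (nhdsWithin 1 (Iio 1)) (nhds (1 - α)) := by
      have := (hid.sub_const α).div hid one_ne_zero
      rwa [div_one] at this
    exact hc.pos_mul_atBot (sub_pos.2 (lt_of_le_of_ne h1 h)) (Real.tendsto_log_nhdsGT_zero.comp hsub)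

lemma tendsto_bmpP {α : ℝ} (h0 : 0 ≤ α) (h1 : α ≤ 1) :
    Tendsto (bmpP α) atTop (nhds (if α = 1 then Real.exp (-1) else 0)) := by
  have hanti : Antitone fun n => bmpP α (n + 1) :=
    antitone_nat_of_succ_le fun n => bmpP_succ_succ_le h0 h1 n
  have hbdd : BddBelow (range fun n => bmpP α (n + 1)) :=
    ⟨0, by rintro _ ⟨n, rfl⟩; exact (bmpP_mem_Icc h0 h1 _).1⟩
  have hconv := (tendsto_add_atTop_iff_nat 1).1 (tendsto_atTop_ciInf hanti hbdd)
  set L := ⨅ n, bmpP α (n + 1)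
  suffices hL : L = if α = 1 then Real.exp (-1) else 0 by rwa [← hL]
  have habel := Real.tendsto_tsum_powerSeries_nhdsWithin_lt
    (f := fun k => bmpP α k - bmpP α (k + 1)) (l := 1 - L) (by
      simp only [Finset.sum_range_sub', bmpP_zero]
      exact hconv.const_sub 1)
  have hid : Tendsto (fun x : ℝ => x) (nhdsWithin 1 (Iio 1)) (nhds 1) :=
    tendsto_id.mono_left nhdsWithin_le_nhds
  have hlim := (tendsto_exp_mul_log_one_sub h1).const_mul (Real.exp (-α))
  have hlim' : Tendsto (fun x : ℝ => Real.exp (-α) * Real.exp ((x - α) / x * Real.log (1 - x)))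
      (nhdsWithin 1 (Iio 1)) (nhds (1 - 1 * (1 - L))) := by
    refine (((hid.mul habel).const_sub 1)).congr' ?_
    filter_upwards [Ioo_mem_nhdsLT (zero_lt_one' ℝ)] with x hx
    rw [← one_sub_mul_tsum_bmpP h0 h1 hx]
    have hs : Summable fun k => bmpP α k * x ^ k := by
      refine (summable_geometric_of_lt_one hx.1.le hx.2).of_nonneg_of_le
        (fun k => mul_nonneg (bmpP_mem_Icc h0 h1 k).1 (pow_nonneg hx.1.le k)) fun k =>
        mul_le_of_le_one_left (pow_nonneg hx.1.le k) (bmpP_mem_Icc h0 h1 k).2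
    have hs' : Summable fun k => bmpP α (k + 1) * x ^ (k + 1) := (summable_nat_add_iff 1).2 hs
    rw [← tsum_mul_left]
    have hterm : ∀ k, x * ((bmpP α k - bmpP α (k + 1)) * x ^ k) =
        x * (bmpP α k * x ^ k) - bmpP α (k + 1) * x ^ (k + 1) := fun k => by ring
    simp only [hterm]
    rw [(hs.mul_left x).tsum_sub hs', tsum_mul_left, hs.tsum_eq_zero_add, bmpP_zero]
    ring
  have := tendsto_nhds_unique hlim' hlim
  split_ifs at this ⊢ with h
  · subst h; linarith
  · linarith

/-- The moment formula for `bmpP α`, with the limit of the sequence as the mass at one. -/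
lemma bmpP_succ_eq_integral {α : ℝ} (h0 : 0 ≤ α) (h1 : α ≤ 1) (n : ℕ) :
    bmpP α (n + 1) = (if α = 1 then Real.exp (-1) else 0) +
      Real.exp (-α) / Real.pi * ∫ x in Ioo (0 : ℝ) 1, bmpDensity α x * x ^ n := by
  set L := if α = 1 then Real.exp (-1) else 0
  have hc : Real.exp (-α) / Real.pi ≠ 0 := by positivity
  have hval : ∀ m, ∫ x in Ioo (0 : ℝ) 1, bmpDensity α x * ((1 - x) * x ^ m) =
      (Real.exp (-α) / Real.pi)⁻¹ * (bmpP α (m + 1) - bmpP α (m + 2)) := fun m => by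
    rw [bmpP_sub_eq_integral h0 h1, inv_mul_cancel_left₀ hc]
  have htel : HasSum (fun m => bmpP α (n + m + 1) - bmpP α (n + m + 2)) (bmpP α (n + 1) - L) := by
    rw [hasSum_iff_tendsto_nat_of_nonneg
      (fun m => sub_nonneg.2 (bmpP_succ_succ_le h0 h1 (n + m)))]
    have hpart : ∀ M, ∑ m ∈ Finset.range M, (bmpP α (n + m + 1) - bmpP α (n + m + 2)) =
        bmpP α (n + 1) - bmpP α (M + (n + 1)) := fun M => by
      have := Finset.sum_range_sub' (fun m => bmpP α (n + m + 1)) M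
      rw [show M + (n + 1) = n + M + 1 by ring]
      simpa [add_assoc] using this
    simp only [hpart]
    exact ((tendsto_add_atTop_iff_nat (n + 1)).2 (tendsto_bmpP h0 h1)).const_sub _
  have hsum := hasSum_integral_of_summable_integral_norm
    (F := fun (m : ℕ) (x : ℝ) => bmpDensity α x * ((1 - x) * x ^ (n + m)))
    (μ := volume.restrict (Ioo 0 1)) (fun m => integrableOn_bmpDensity_mul h0 h1 (n + m)) (by
      have : ∀ m, ∫ x in Ioo (0 : ℝ) 1, ‖bmpDensity α x * ((1 - x) * x ^ (n + m))‖ =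
          ∫ x in Ioo (0 : ℝ) 1, bmpDensity α x * ((1 - x) * x ^ (n + m)) := fun m => by
        refine setIntegral_congr_fun measurableSet_Ioo fun x hx => ?_
        have hx' : 0 < 1 - x := by linarith [hx.2]
        have hx0 := hx.1
        exact Real.norm_of_nonneg (mul_nonneg (bmpDensity_nonneg h0 h1 hx) (by positivity))
      simp only [this, hval]
      exact htel.summable.mul_left _)
  simp only [hval] at hsum
  have hpt : ∫ x in Ioo (0 : ℝ) 1, ∑' m, bmpDensity α x * ((1 - x) * x ^ (n + m)) =
      ∫ x in Ioo (0 : ℝ) 1, bmpDensity α x * x ^ n := by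
    refine setIntegral_congr_fun measurableSet_Ioo fun x hx => ?_
    have hx' : 1 - x ≠ 0 := by linarith [hx.2]
    have hgeo := (hasSum_geometric_of_lt_one hx.1.le hx.2).mul_left
      (bmpDensity α x * (1 - x) * x ^ n)
    have : bmpDensity α x * (1 - x) * x ^ n * (1 - x)⁻¹ = bmpDensity α x * x ^ n := by
      field_simp
    rw [this] at hgeo
    refine HasSum.tsum_eq ?_
    refine hgeo.congr_fun fun m => ?_
    rw [pow_add]
    ring
  rw [hpt] at hsum
  rw [hsum.unique (htel.mul_left _), mul_inv_cancel_left₀ hc]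
  ring

lemma bmpP_one {K : Type*} [Field K] (α : K) : bmpP α 1 = α / 2 := by
  rw [bmpP_succ]
  simp [bmpP_zero, div_eq_mul_inv]

lemma integrableOn_bmpDensity {α : ℝ} (h0 : 0 < α) (h1 : α ≤ 1) :
    IntegrableOn (bmpDensity α) (Ioo 0 1) := by
  by_contra h
  have key := bmpP_succ_eq_integral h0.le h1 0
  simp only [pow_zero, mul_one] at key
  rw [integral_undef h, mul_zero, add_zero, zero_add, bmpP_one] at key
  split_ifs at key with hα
  · have h2 : Real.exp 1 * Real.exp (-1) = 1 := by rw [← Real.exp_add]; simp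
    rw [← key, hα] at h2
    linarith [Real.exp_one_gt_d9]
  · linarith

/-- Moment formulas for `p_{n+1}(α)`, `0 < α ≤ 1`, showing `(p_{n+1}(α))_{n≥0}` is a
Hausdorff moment sequence. -/
theorem stmt10 :
    (∀ α : ℝ, 0 < α → α < 1 → ∀ n : ℕ,
      bmpP α (n + 1) = (Real.exp (-α) / Real.pi) *
        ∫ x in Set.Ioo (0 : ℝ) 1,
          (x / (1 - x)) ^ (α * x) * Real.sin (α * Real.pi * x) * x ^ n) ∧
    (∀ n : ℕ, bmpP (1 : ℝ) (n + 1) = Real.exp (-1) + (Real.exp (-1) / Real.pi) *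
        ∫ x in Set.Ioo (0 : ℝ) 1, (x / (1 - x)) ^ x * Real.sin (Real.pi * x) * x ^ n) ∧
    (∀ α : ℝ, 0 < α → α ≤ 1 → ∃ σ : MeasureTheory.Measure ℝ,
      MeasureTheory.IsFiniteMeasure σ ∧ σ (Set.Icc 0 1)ᶜ = 0 ∧
      ∀ n : ℕ, bmpP α (n + 1) = ∫ x, x ^ n ∂σ) := by
  refine ⟨fun α h0 h1 n => ?_, fun n => ?_, fun α h0 h1 => ?_⟩
  · have := bmpP_succ_eq_integral h0.le h1.le n
    rw [if_neg h1.ne, zero_add] at this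
    exact this
  · have := bmpP_succ_eq_integral zero_le_one le_rfl n
    simpa [bmpDensity] using this
  · set L := if α = 1 then Real.exp (-1) else 0 with hL
    have hL0 : 0 ≤ L := by rw [hL]; positivity
    set c := Real.exp (-α) / Real.pi with hc
    have hc0 : 0 ≤ c := by positivity
    have hinteg : IntegrableOn (fun x => c * bmpDensity α x) (Ioo 0 1) :=
      (integrableOn_bmpDensity h0 h1).const_mul c
    have hmeas : Measurable fun x => ENNReal.ofReal (c * bmpDensity α x) :=
      ((measurable_bmpDensity α).const_mul c).ennreal_ofReal
    set μ : Measure ℝ := (volume.restrict (Ioo (0 : ℝ) 1)).withDensity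
      fun x => ENNReal.ofReal (c * bmpDensity α x) with hμ
    set ν : Measure ℝ := ENNReal.ofReal L • Measure.dirac 1 with hν
    have hμfin : IsFiniteMeasure μ := isFiniteMeasure_withDensity_ofReal hinteg.2
    have hνfin : IsFiniteMeasure ν := Measure.smul_finite _ ENNReal.ofReal_ne_top
    have hμ0 : μ (Icc 0 1)ᶜ = 0 := by
      refine withDensity_absolutelyContinuous _ _ ?_
      rw [Measure.restrict_apply measurableSet_Icc.compl]
      have : (Icc (0 : ℝ) 1)ᶜ ∩ Ioo 0 1 = ∅ :=
        Set.eq_empty_of_forall_notMem fun x hx => hx.1 (Ioo_subset_Icc_self hx.2)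
      rw [this, measure_empty]
    have hν0 : ν (Icc 0 1)ᶜ = 0 := by
      simp [hν]
    have hbounded : ∀ (κ : Measure ℝ) [IsFiniteMeasure κ], κ (Icc 0 1)ᶜ = 0 → ∀ n : ℕ,
        Integrable (fun x : ℝ => x ^ n) κ := fun κ _ hκ n => by
      refine Integrable.of_bound (by fun_prop) 1 ?_
      filter_upwards [mem_ae_iff.2 hκ] with x hx
      rw [norm_pow, Real.norm_of_nonneg hx.1]
      exact pow_le_one₀ hx.1 hx.2
    refine ⟨μ + ν, inferInstance, ?_, fun n => ?_⟩
    · rw [Measure.add_apply, hμ0, hν0, add_zero]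
    · rw [integral_add_measure (hbounded μ hμ0 n) (hbounded ν hν0 n), hμ, hν,
        integral_withDensity_eq_integral_toReal_smul hmeas (by simp), integral_smul_measure,
        integral_dirac, bmpP_succ_eq_integral h0.le h1 n, ← hL, ← hc, ← integral_const_mul,
        ENNReal.toReal_ofReal hL0, one_pow, smul_eq_mul, mul_one, add_comm]
      congr 1
      refine setIntegral_congr_fun measurableSet_Ioo fun x hx => ?_
      rw [ENNReal.toReal_ofReal (mul_nonneg hc0 (bmpDensity_nonneg h0.le h1 hx)), smul_eq_mul,
        mul_assoc]
end
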